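/- arXiv:2003.02696 — 3 statements merged into one kernel-verified Lean document; each statement's English description precedes it below -/
import Mathlib

section
/- Let f ∈ L^∞(I×ℝ) and let L ∈ (0, c_p^{-2}) (with c_p = 2/π) be such that |f(s,v₁) − f(s,v₂)| ≤ L|v₁−v₂| for a.e. s ∈ I and all v₁, v₂ ∈ ℝ. Then there exists a unique weak solution v ∈ H^1_{0L}(I) of the boundary value problem −v'' + f(s,v) = 0 in I, v(0)=0, v'(1)=0, i.e. a unique v ∈ H^1_{0L}(I) such that ∫₀¹ v'w' + ∫₀¹ f(s,v)w = 0 for all w ∈ H^1_{0L}(I). Moreover this solution satisfies ‖v‖ ≤ c_p/(1 − L c_p²) · ‖f(·,0)‖_∞ and ‖v‖_∞ ≤ ‖f‖_∞. -/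
open MeasureTheory Set

/-- The space `H^1_{0L}(I)`, `I = (0,1)`: absolutely continuous functions on `[0,1]`
vanishing at `0` whose (weak) derivative is square integrable.  An element is recorded
together with its weak derivative `f'`, and `f t = ∫₀ᵗ f'`. -/
structure H1L where
  f : ℝ → ℝ
  f' : ℝ → ℝ
  int : IntervalIntegrable f' volume 0 1
  sq : IntervalIntegrable (fun s => (f' s) ^ 2) volume 0 1
  repr : ∀ t ∈ Icc (0 : ℝ) 1, f t = ∫ s in (0 : ℝ)..t, f' s

/-- `v` is a weak solution of `-v'' + φ(s,v) = 0` in `(0,1)`, `v(0) = 0`, `v'(1) = 0`: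
`∫₀¹ v' w' + ∫₀¹ φ(s, v(s)) w(s) = 0` for all `w ∈ H^1_{0L}(I)`. -/
def IsWeakSol (φ : ℝ → ℝ → ℝ) (v : H1L) : Prop :=
  ∀ w : H1L,
    (∫ s in (0 : ℝ)..1, v.f' s * w.f' s) + ∫ s in (0 : ℝ)..1, φ s (v.f s) * w.f s = 0

/-- Almost everywhere statements on `(0,1)` transfer to `(0,1]`. -/
lemma ae_Ioc_of_ae_Ioo {P : ℝ → Prop} (h : ∀ᵐ s ∂(volume.restrict (Ioo (0 : ℝ) 1)), P s) :
    ∀ᵐ s, s ∈ Ioc (0 : ℝ) 1 → P s := by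
  rwa [Measure.restrict_congr_set Ioo_ae_eq_Ioc, ae_restrict_iff' measurableSet_Ioc] at h

lemma nonneg_of_ae_Ioo {P : ℝ → Prop} {c : ℝ}
    (h : ∀ᵐ s ∂(volume.restrict (Ioo (0 : ℝ) 1)), P s) (hP : ∀ s, P s → 0 ≤ c) : 0 ≤ c := by
  have : NeZero (volume.restrict (Ioo (0 : ℝ) 1)) := ⟨by simp [Measure.restrict_eq_zero]⟩
  obtain ⟨s, hs⟩ := h.exists
  exact hP s hs

lemma continuousOn_primitive {g : ℝ → ℝ} (hg : IntervalIntegrable g volume 0 1) :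
    ContinuousOn (fun t => ∫ s in (0 : ℝ)..t, g s) (uIcc 0 1) :=
  (hg.absolutelyContinuousOnInterval_intervalIntegral (c := 0) (by simp)).continuousOn

/-- Integration by parts for primitives of integrable functions. -/
lemma integral_primitive_mul {a b : ℝ → ℝ} (ha : IntervalIntegrable a volume 0 1)
    (hb : IntervalIntegrable b volume 0 1) :
    ∫ s in (0 : ℝ)..1, (-∫ r in s..1, a r) * b s =
      -∫ s in (0 : ℝ)..1, a s * ∫ r in (0 : ℝ)..s, b r := by
  have hA : AbsolutelyContinuousOnInterval (fun x ↦ ∫ v in (1 : ℝ)..x, a v) 0 1 :=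
    ha.absolutelyContinuousOnInterval_intervalIntegral (by simp)
  have hB : AbsolutelyContinuousOnInterval (fun x ↦ ∫ v in (0 : ℝ)..x, b v) 0 1 :=
    hb.absolutelyContinuousOnInterval_intervalIntegral (by simp)
  have key := hA.integral_mul_deriv_eq_deriv_mul hB
  have h1 : ∫ s in (0 : ℝ)..1, (-∫ r in s..1, a r) * b s =
      ∫ x in (0 : ℝ)..1, (∫ v in (1 : ℝ)..x, a v) * deriv (fun x ↦ ∫ v in (0 : ℝ)..x, b v) x := by
    apply intervalIntegral.integral_congr_ae
    filter_upwards [hb.ae_hasDerivAt_integral] with x hx hxm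
    rw [(hx (uIoc_subset_uIcc hxm) 0 (by simp)).deriv, ← intervalIntegral.integral_symm]
  have h2 : ∫ s in (0 : ℝ)..1, a s * ∫ r in (0 : ℝ)..s, b r =
      ∫ x in (0 : ℝ)..1, deriv (fun x ↦ ∫ v in (1 : ℝ)..x, a v) x * (∫ v in (0 : ℝ)..x, b v) := by
    apply intervalIntegral.integral_congr_ae
    filter_upwards [ha.ae_hasDerivAt_integral] with x hx hxm
    rw [(hx (uIoc_subset_uIcc hxm) 1 (by simp)).deriv]
  rw [h1, h2, key]
  simp

/-- The angle `α (1 - t)` has positive cosine on `[0,1]` when `0 ≤ α < π/2`. -/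
lemma cos_weight_pos {α t : ℝ} (h0 : 0 ≤ α) (h1 : α < Real.pi / 2) (ht : t ∈ Icc (0 : ℝ) 1) :
    0 < Real.cos (α * (1 - t)) := by
  apply Real.cos_pos_of_mem_Ioo
  constructor
  · nlinarith [mul_nonneg h0 (sub_nonneg.2 ht.2), Real.pi_pos]
  · nlinarith [mul_nonneg h0 ht.1]

/-- Riccati form of the Poincaré inequality, with a non-optimal constant. -/
lemma poincare_of_lt {g : ℝ → ℝ} (hg : IntervalIntegrable g volume 0 1)
    (hg2 : IntervalIntegrable (fun s => g s ^ 2) volume 0 1)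
    {α : ℝ} (h0 : 0 ≤ α) (h1 : α < Real.pi / 2) :
    α ^ 2 * ∫ t in (0 : ℝ)..1, (∫ s in (0 : ℝ)..t, g s) ^ 2 ≤ ∫ t in (0 : ℝ)..1, g t ^ 2 := by
  set V : ℝ → ℝ := fun t => ∫ s in (0 : ℝ)..t, g s with hV
  set p : ℝ → ℝ := fun t => α * (Real.sin (α * (1 - t)) / Real.cos (α * (1 - t))) with hp
  have hVac : AbsolutelyContinuousOnInterval V 0 1 :=
    hg.absolutelyContinuousOnInterval_intervalIntegral (by simp)
  have hpos : ∀ t ∈ uIcc (0 : ℝ) 1, Real.cos (α * (1 - t)) ≠ 0 := fun t ht =>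
    (cos_weight_pos h0 h1 (by simpa using ht)).ne'
  have hpac : AbsolutelyContinuousOnInterval p 0 1 := by
    apply ContDiffOn.absolutelyContinuousOnInterval
    apply contDiffOn_const.mul
    apply ContDiffOn.div _ _ hpos
    · exact (Real.contDiff_sin.comp (by fun_prop)).contDiffOn
    · exact (Real.contDiff_cos.comp (by fun_prop)).contDiffOn
  have hpd : ∀ t ∈ uIcc (0 : ℝ) 1, HasDerivAt p (-α ^ 2 - p t ^ 2) t := by
    intro t ht
    have hl : HasDerivAt (fun t : ℝ => α * (1 - t)) (-α) t := by
      simpa using ((hasDerivAt_id t).const_sub 1).const_mul α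
    have := ((hl.sin.div hl.cos (hpos t ht))).const_mul α
    refine this.congr_deriv ?_
    have := hpos t ht
    simp only [hp]
    field_simp
  have hac := (hVac.mul hVac).mul hpac
  have hint := hac.integral_deriv_eq_sub
  have hz : (V * V * p) 1 - (V * V * p) 0 = 0 := by simp [hV, hp]
  rw [hz] at hint
  have hVc : ContinuousOn V (uIcc 0 1) := hVac.continuousOn
  have hV2 : IntervalIntegrable (fun t => V t ^ 2) volume 0 1 := (hVc.pow 2).intervalIntegrable
  rw [← intervalIntegral.integral_const_mul]
  calc ∫ t in (0 : ℝ)..1, α ^ 2 * V t ^ 2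
      = ∫ t in (0 : ℝ)..1, (deriv (V * V * p) t + α ^ 2 * V t ^ 2) := by
        rw [intervalIntegral.integral_add hac.intervalIntegrable_deriv (hV2.const_mul _), hint,
          zero_add]
    _ ≤ ∫ t in (0 : ℝ)..1, g t ^ 2 := by
        apply intervalIntegral.integral_mono_ae_restrict zero_le_one
          (hac.intervalIntegrable_deriv.add (hV2.const_mul _)) hg2
        rw [Filter.EventuallyLE, ae_restrict_iff' measurableSet_Icc]
        filter_upwards [hg.ae_hasDerivAt_integral] with t ht htm
        have htm' : t ∈ uIcc (0 : ℝ) 1 := by simpa using htm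
        have hVd : HasDerivAt V (g t) t := ht htm' 0 (by simp)
        rw [((hVd.mul hVd).mul (hpd t htm')).deriv]
        simp only [Pi.mul_apply]
        nlinarith [sq_nonneg (g t - V t * p t)]

/-- The Poincaré inequality with the optimal constant `2/π`. -/
lemma poincare {g : ℝ → ℝ} (hg : IntervalIntegrable g volume 0 1)
    (hg2 : IntervalIntegrable (fun s => g s ^ 2) volume 0 1) :
    (Real.pi / 2) ^ 2 * ∫ t in (0 : ℝ)..1, (∫ s in (0 : ℝ)..t, g s) ^ 2 ≤
      ∫ t in (0 : ℝ)..1, g t ^ 2 := by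
  have hlim : Filter.Tendsto
      (fun α : ℝ => α ^ 2 * ∫ t in (0 : ℝ)..1, (∫ s in (0 : ℝ)..t, g s) ^ 2)
      (nhdsWithin (Real.pi / 2) (Iio (Real.pi / 2)))
      (nhds ((Real.pi / 2) ^ 2 * ∫ t in (0 : ℝ)..1, (∫ s in (0 : ℝ)..t, g s) ^ 2)) :=
    ((continuous_pow 2).mul continuous_const).continuousWithinAt
  refine le_of_tendsto hlim ?_
  filter_upwards [Ioo_mem_nhdsLT (show (0 : ℝ) < Real.pi / 2 by positivity)] with α hα
  exact poincare_of_lt hg hg2 hα.1.le hα.2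

namespace H1L

lemma continuousOn (v : H1L) : ContinuousOn v.f (uIcc 0 1) :=
  (continuousOn_primitive v.int).congr fun t ht => v.repr t (by simpa using ht)

lemma poincare (v : H1L) :
    (Real.pi / 2) ^ 2 * ∫ t in (0 : ℝ)..1, v.f t ^ 2 ≤ ∫ t in (0 : ℝ)..1, v.f' t ^ 2 := by
  convert! _root_.poincare v.int v.sq using 2
  refine intervalIntegral.integral_congr fun t ht => ?_
  simp only [v.repr t (by simpa using ht)]

lemma memLp_deriv (v : H1L) : MemLp v.f' 2 (volume.restrict (Ioc 0 1)) :=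
  (memLp_two_iff_integrable_sq v.int.1.aestronglyMeasurable).2 v.sq.1

lemma intervalIntegrable_deriv_mul (v w : H1L) :
    IntervalIntegrable (fun s => v.f' s * w.f' s) volume 0 1 :=
  (intervalIntegrable_iff_integrableOn_Ioc_of_le zero_le_one).2
    (v.memLp_deriv.integrable_mul w.memLp_deriv)

/-- The difference of two elements of `H^1_{0L}(I)`. -/
def sub (v w : H1L) : H1L where
  f := fun t => v.f t - w.f t
  f' := fun t => v.f' t - w.f' t
  int := v.int.sub w.int
  sq := (intervalIntegrable_iff_integrableOn_Ioc_of_le zero_le_one).2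
    (v.memLp_deriv.sub w.memLp_deriv).integrable_sq
  repr := fun t ht => by
    have hsub : uIcc 0 t ⊆ uIcc (0 : ℝ) 1 := by
      rw [uIcc_of_le ht.1, uIcc_of_le zero_le_one]
      exact Icc_subset_Icc_right ht.2
    rw [v.repr t ht, w.repr t ht,
      intervalIntegral.integral_sub (v.int.mono_set hsub) (w.int.mono_set hsub)]

/-- An element of zero energy vanishes. -/
lemma eq_zero_of_energy_nonpos (v : H1L) (h : ∫ s in (0 : ℝ)..1, v.f' s ^ 2 ≤ 0) :
    ∀ t ∈ Icc (0 : ℝ) 1, v.f t = 0 := by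
  have h0 : ∫ s in (0 : ℝ)..1, v.f' s ^ 2 = 0 :=
    le_antisymm h (intervalIntegral.integral_nonneg zero_le_one fun s _ => sq_nonneg _)
  rw [intervalIntegral.integral_eq_zero_iff_of_le_of_nonneg_ae zero_le_one
    (ae_of_all _ fun s => sq_nonneg _) v.sq, Filter.EventuallyEq,
    ae_restrict_iff' measurableSet_Ioc] at h0
  intro t ht
  rw [v.repr t ht]
  refine (intervalIntegral.integral_congr_ae (g := fun _ => 0) ?_).trans (by simp)
  filter_upwards [h0] with s hs hst
  rw [uIoc_of_le ht.1] at hst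
  simpa using hs ⟨hst.1, hst.2.trans ht.2⟩

end H1L

section Nonlinearity

variable {φ : ℝ → ℝ → ℝ} {M L : ℝ}

/-- The superposition `s ↦ φ(s, v(s))` is integrable when `φ` is bounded. -/
lemma intervalIntegrable_superposition (hmeas : Measurable (Function.uncurry φ))
    (hM : ∀ᵐ s ∂(volume.restrict (Ioo (0:ℝ) 1)), ∀ x, |φ s x| ≤ M)
    {v : ℝ → ℝ} (hv : ContinuousOn v (uIcc 0 1)) :
    IntervalIntegrable (fun s => φ s (v s)) volume 0 1 := by
  have hvm : AEMeasurable v (volume.restrict (Ioc 0 1)) :=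
    hv.intervalIntegrable.1.aestronglyMeasurable.aemeasurable
  have hm : AEMeasurable (fun s => φ s (v s)) (volume.restrict (Ioc 0 1)) :=
    hmeas.comp_aemeasurable (aemeasurable_id.prodMk hvm)
  rw [intervalIntegrable_iff_integrableOn_Ioc_of_le zero_le_one]
  refine Integrable.of_bound hm.aestronglyMeasurable M ?_
  rw [Measure.restrict_congr_set Ioo_ae_eq_Ioc] at hM
  filter_upwards [hM] with s hs using hs _

/-- Two weak solutions for the same nonlinearity agree on `[0,1]`. -/
lemma IsWeakSol.eq (hmeas : Measurable (Function.uncurry φ))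
    (hM : ∀ᵐ s ∂(volume.restrict (Ioo (0:ℝ) 1)), ∀ x, |φ s x| ≤ M)
    (hL0 : 0 < L) (hL : L < Real.pi ^ 2 / 4)
    (hLip : ∀ᵐ s ∂(volume.restrict (Ioo (0:ℝ) 1)), ∀ x y, |φ s x - φ s y| ≤ L * |x - y|)
    {v w : H1L} (hv : IsWeakSol φ v) (hw : IsWeakSol φ w) :
    ∀ t ∈ Icc (0 : ℝ) 1, v.f t = w.f t := by
  set D := v.sub w with hD
  have hφv := (intervalIntegrable_superposition hmeas hM v.continuousOn).mul_continuousOn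
    D.continuousOn
  have hφw := (intervalIntegrable_superposition hmeas hM w.continuousOn).mul_continuousOn
    D.continuousOn
  have hD2 : IntervalIntegrable (fun s => D.f s ^ 2) volume 0 1 :=
    (D.continuousOn.pow 2).intervalIntegrable
  have hE : ∫ s in (0 : ℝ)..1, D.f' s ^ 2 =
      -∫ s in (0 : ℝ)..1, (φ s (v.f s) * D.f s - φ s (w.f s) * D.f s) := by
    have h1 : ∫ s in (0 : ℝ)..1, D.f' s ^ 2 =
        ∫ s in (0 : ℝ)..1, (v.f' s * D.f' s - w.f' s * D.f' s) :=
      intervalIntegral.integral_congr fun s _ => by simp only [hD, H1L.sub]; ring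
    rw [h1, intervalIntegral.integral_sub (v.intervalIntegrable_deriv_mul D)
      (w.intervalIntegrable_deriv_mul D), intervalIntegral.integral_sub hφv hφw]
    linarith [hv D, hw D]
  have hle : ∫ s in (0 : ℝ)..1, D.f' s ^ 2 ≤ L * ∫ s in (0 : ℝ)..1, D.f s ^ 2 := by
    rw [hE, ← intervalIntegral.integral_const_mul]
    refine (neg_le_abs _).trans ?_
    refine intervalIntegral.norm_integral_le_of_norm_le (E := ℝ) zero_le_one ?_ (hD2.const_mul L)
    filter_upwards [ae_Ioc_of_ae_Ioo hLip] with s hs hsm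
    rw [← sub_mul, Real.norm_eq_abs, abs_mul, ← sq_abs, sq, ← mul_assoc]
    exact mul_le_mul_of_nonneg_right (hs hsm _ _) (abs_nonneg _)
  have hP := D.poincare
  have h0 : 0 ≤ ∫ s in (0 : ℝ)..1, D.f s ^ 2 :=
    intervalIntegral.integral_nonneg zero_le_one fun s _ => sq_nonneg _
  have hE0 : ∫ s in (0 : ℝ)..1, D.f' s ^ 2 ≤ 0 := by nlinarith
  intro t ht
  exact sub_eq_zero.1 (D.eq_zero_of_energy_nonpos hE0 t ht)

/-- The energy estimate for weak solutions. -/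
lemma IsWeakSol.energy_le
    (hL0 : 0 < L) (hL : L < Real.pi ^ 2 / 4)
    (hLip : ∀ᵐ s ∂(volume.restrict (Ioo (0:ℝ) 1)), ∀ x y, |φ s x - φ s y| ≤ L * |x - y|)
    {v : H1L} (hv : IsWeakSol φ v) {C : ℝ}
    (hC : ∀ᵐ s ∂(volume.restrict (Ioo (0:ℝ) 1)), |φ s 0| ≤ C) :
    Real.sqrt (∫ s in (0 : ℝ)..1, (v.f' s) ^ 2) ≤
      (2 / Real.pi) / (1 - L * (2 / Real.pi) ^ 2) * C := by
  have hC0 : 0 ≤ C := nonneg_of_ae_Ioo hC fun s hs => (abs_nonneg _).trans hs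
  have hP := v.poincare
  have h2 : IntervalIntegrable (fun s => v.f s ^ 2) volume 0 1 :=
    (v.continuousOn.pow 2).intervalIntegrable
  have habs : IntervalIntegrable (fun s => |v.f s|) volume 0 1 :=
    v.continuousOn.abs.intervalIntegrable
  set E := ∫ s in (0 : ℝ)..1, v.f' s ^ 2 with hE
  set S := ∫ s in (0 : ℝ)..1, v.f s ^ 2 with hS
  set m := ∫ s in (0 : ℝ)..1, |v.f s| with hm
  have hE0 : 0 ≤ E := intervalIntegral.integral_nonneg zero_le_one fun s _ => sq_nonneg _
  have hS0 : 0 ≤ S := intervalIntegral.integral_nonneg zero_le_one fun s _ => sq_nonneg _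
  have hmS : m ^ 2 ≤ S := by
    have h : 0 ≤ ∫ s in (0 : ℝ)..1, (v.f s ^ 2 - 2 * m * |v.f s| + m ^ 2) := by
      refine intervalIntegral.integral_nonneg zero_le_one fun s _ => ?_
      nlinarith [sq_nonneg (|v.f s| - m), sq_abs (v.f s)]
    rw [intervalIntegral.integral_add (h2.sub (habs.const_mul _)) (by simp),
      intervalIntegral.integral_sub h2 (habs.const_mul _),
      intervalIntegral.integral_const_mul] at h
    simp only [intervalIntegral.integral_const, sub_zero, smul_eq_mul, one_mul] at h
    nlinarith
  have hle : E ≤ L * S + C * m := by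
    have hEq : E = -∫ s in (0 : ℝ)..1, φ s (v.f s) * v.f s := by
      have := hv v
      simp only [← sq] at this
      linarith
    rw [hEq, hS, hm, ← intervalIntegral.integral_const_mul,
      ← intervalIntegral.integral_const_mul,
      ← intervalIntegral.integral_add (h2.const_mul _) (habs.const_mul _)]
    refine (neg_le_abs _).trans ?_
    refine intervalIntegral.norm_integral_le_of_norm_le (E := ℝ) zero_le_one ?_
      ((h2.const_mul _).add (habs.const_mul _))
    filter_upwards [ae_Ioc_of_ae_Ioo hLip, ae_Ioc_of_ae_Ioo hC] with s hs hs0 hsm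
    have hb : |φ s (v.f s)| ≤ L * |v.f s| + C := by
      have h := hs hsm (v.f s) 0
      rw [sub_zero] at h
      linarith [abs_sub_abs_le_abs_sub (φ s (v.f s)) (φ s 0), hs0 hsm]
    rw [Real.norm_eq_abs, abs_mul, ← sq_abs (v.f s)]
    nlinarith [mul_le_mul_of_nonneg_right hb (abs_nonneg (v.f s))]
  set c := 2 / Real.pi with hc
  have hcpos : 0 < c := by positivity
  have hcinv : Real.pi / 2 * c = 1 := by rw [hc]; field_simp
  have hLc : 0 < 1 - L * c ^ 2 := by
    have : Real.pi ^ 2 / 4 * c ^ 2 = 1 := by linear_combination (Real.pi / 2 * c + 1) * hcinv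
    nlinarith [mul_lt_mul_of_pos_right hL (pow_pos hcpos 2)]
  have hSE : S ≤ c ^ 2 * E := by
    have := mul_le_mul_of_nonneg_left hP (sq_nonneg c)
    calc S = c ^ 2 * ((Real.pi / 2) ^ 2 * S) := by
          linear_combination (-(Real.pi / 2 * c + 1) * S) * hcinv
      _ ≤ _ := this
  set e := Real.sqrt E with he
  have hee : e ^ 2 = E := Real.sq_sqrt hE0
  have he0 : 0 ≤ e := Real.sqrt_nonneg _
  have hme : m ≤ c * e := by
    apply le_of_sq_le_sq _ (by positivity)
    rw [mul_pow, hee]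
    exact hmS.trans hSE
  have hfin : e * (e * (1 - L * c ^ 2)) ≤ e * (c * C) := by
    nlinarith [mul_le_mul_of_nonneg_left hSE hL0.le, mul_le_mul_of_nonneg_left hme hC0]
  rw [div_mul_eq_mul_div, le_div_iff₀ hLc]
  rcases he0.eq_or_lt with h | h
  · rw [← h, zero_mul]; positivity
  · exact le_of_mul_le_mul_left hfin h

/-- The solution of `-v'' + g = 0`, `v(0) = 0`, `v'(1) = 0`. -/
noncomputable def H1L.ofSource (g : ℝ → ℝ) (hg : IntervalIntegrable g volume 0 1) : H1L :=
  have hc : ContinuousOn (fun s => -∫ r in s..1, g r) (uIcc 0 1) := by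
    simp_rw [← intervalIntegral.integral_symm]
    exact (hg.absolutelyContinuousOnInterval_intervalIntegral (c := 1) (by simp)).continuousOn
  { f := fun t => ∫ s in (0 : ℝ)..t, -∫ r in s..1, g r
    f' := fun s => -∫ r in s..1, g r
    int := hc.intervalIntegrable
    sq := (hc.pow 2).intervalIntegrable
    repr := fun _ _ => rfl }

/-- A fixed point of the integral operator is a weak solution. -/
lemma H1L.isWeakSol_ofSource {g : ℝ → ℝ} (hg : IntervalIntegrable g volume 0 1)
    (hfix : ∀ s ∈ Icc (0 : ℝ) 1, φ s ((H1L.ofSource g hg).f s) = g s) :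
    IsWeakSol φ (H1L.ofSource g hg) := by
  intro w
  have h : ∫ s in (0 : ℝ)..1, φ s ((H1L.ofSource g hg).f s) * w.f s =
      ∫ s in (0 : ℝ)..1, g s * ∫ r in (0 : ℝ)..s, w.f' r := by
    refine intervalIntegral.integral_congr fun s hs => ?_
    rw [uIcc_of_le zero_le_one] at hs
    simp only [hfix s hs, w.repr s hs]
  rw [h]
  have := integral_primitive_mul hg w.int
  simp only [H1L.ofSource]
  linarith

lemma H1L.abs_ofSource_le {g : ℝ → ℝ} (hg : IntervalIntegrable g volume 0 1) {C : ℝ}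
    (hC0 : 0 ≤ C) (hC : ∀ᵐ s, s ∈ Ioc (0 : ℝ) 1 → |g s| ≤ C) :
    ∀ t ∈ Icc (0 : ℝ) 1, |(H1L.ofSource g hg).f t| ≤ C := by
  intro t ht
  have hinner : ∀ s ∈ Icc (0 : ℝ) 1, |-∫ r in s..1, g r| ≤ C := by
    intro s hs
    rw [abs_neg]
    refine (intervalIntegral.norm_integral_le_of_norm_le_const_ae (E := ℝ) (C := C) ?_).trans ?_
    · filter_upwards [hC] with r hr hrs
      rw [uIoc_of_le hs.2] at hrs
      exact hr ⟨hs.1.trans_lt hrs.1, hrs.2⟩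
    · rw [abs_of_nonneg (sub_nonneg.2 hs.2)]
      nlinarith [hs.1]
  refine (intervalIntegral.norm_integral_le_of_norm_le_const (E := ℝ) (C := C) ?_).trans ?_
  · intro s hs
    rw [uIoc_of_le ht.1] at hs
    exact hinner s ⟨hs.1.le, hs.2.trans ht.2⟩
  · rw [sub_zero, abs_of_nonneg ht.1]
    nlinarith [ht.2]

/-- The solution operator is a contraction in the norm weighted by `t ↦ cos (α (1 - t))`. -/
lemma H1L.abs_ofSource_sub_le {g h : ℝ → ℝ} (hg : IntervalIntegrable g volume 0 1)
    (hh : IntervalIntegrable h volume 0 1) {α C : ℝ} (hα0 : 0 < α) (hα1 : α < Real.pi / 2)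
    (hC0 : 0 ≤ C)
    (hC : ∀ᵐ s, s ∈ Ioc (0 : ℝ) 1 → |g s - h s| ≤ C * Real.cos (α * (1 - s))) :
    ∀ t ∈ Icc (0 : ℝ) 1, |(H1L.ofSource g hg).f t - (H1L.ofSource h hh).f t| ≤
      C / α ^ 2 * Real.cos (α * (1 - t)) := by
  intro t ht
  have hl : ∀ s : ℝ, HasDerivAt (fun s : ℝ => α * (1 - s)) (-α) s := fun s => by
    simpa using ((hasDerivAt_id s).const_sub 1).const_mul α
  have hsub : ∀ s ∈ Icc (0 : ℝ) 1, uIcc s 1 ⊆ uIcc (0 : ℝ) 1 := fun s hs => by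
    rw [uIcc_of_le hs.2, uIcc_of_le zero_le_one]
    exact Icc_subset_Icc_left hs.1
  have hsub' : uIcc 0 t ⊆ uIcc (0 : ℝ) 1 := by
    rw [uIcc_of_le ht.1, uIcc_of_le zero_le_one]
    exact Icc_subset_Icc_right ht.2
  have hinner : ∀ s ∈ Icc (0 : ℝ) 1, |(-∫ r in s..1, g r) - (-∫ r in s..1, h r)| ≤
      C / α * Real.sin (α * (1 - s)) := by
    intro s hs
    have hI : ∫ r in s..1, C * Real.cos (α * (1 - r)) = C / α * Real.sin (α * (1 - s)) := by
      rw [intervalIntegral.integral_eq_sub_of_hasDerivAt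
        (f := fun r => -(C / α * Real.sin (α * (1 - r)))) ?_
        (by apply Continuous.intervalIntegrable; fun_prop)]
      · simp
      · intro r _
        refine ((hl r).sin.const_mul (C / α)).neg.congr_deriv ?_
        field_simp
    rw [← neg_sub', abs_neg, ← intervalIntegral.integral_sub (hg.mono_set (hsub s hs))
      (hh.mono_set (hsub s hs)), ← hI]
    refine intervalIntegral.norm_integral_le_of_norm_le (E := ℝ) hs.2 ?_
      (by apply Continuous.intervalIntegrable; fun_prop)
    filter_upwards [hC] with r hr hrs
    exact hr ⟨hs.1.trans_lt hrs.1, hrs.2⟩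
  have hO : ∫ s in (0 : ℝ)..t, C / α * Real.sin (α * (1 - s)) =
      C / α ^ 2 * Real.cos (α * (1 - t)) - C / α ^ 2 * Real.cos (α * (1 - 0)) := by
    rw [intervalIntegral.integral_eq_sub_of_hasDerivAt
      (f := fun s => C / α ^ 2 * Real.cos (α * (1 - s))) ?_
      (by apply Continuous.intervalIntegrable; fun_prop)]
    intro r _
    refine ((hl r).cos.const_mul (C / α ^ 2)).congr_deriv ?_
    field_simp
  have hcos := cos_weight_pos hα0.le hα1 (t := 0) (by simp)
  have hmain : |(H1L.ofSource g hg).f t - (H1L.ofSource h hh).f t| ≤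
      ∫ s in (0 : ℝ)..t, C / α * Real.sin (α * (1 - s)) := by
    rw [(H1L.ofSource g hg).repr t ht, (H1L.ofSource h hh).repr t ht,
      ← intervalIntegral.integral_sub ((H1L.ofSource g hg).int.mono_set hsub')
      ((H1L.ofSource h hh).int.mono_set hsub')]
    refine intervalIntegral.norm_integral_le_of_norm_le (E := ℝ) ht.1 (ae_of_all _ ?_)
      (by apply Continuous.intervalIntegrable; fun_prop)
    intro s hs
    exact hinner s ⟨hs.1.le, hs.2.trans ht.2⟩
  rw [hO] at hmain
  have : 0 ≤ C / α ^ 2 * Real.cos (α * (1 - 0)) := by positivity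
  linarith

/-- The nonlinear integral operator has a fixed point. -/
lemma exists_fixedPoint (hmeas : Measurable (Function.uncurry φ))
    (hM : ∀ᵐ s ∂(volume.restrict (Ioo (0:ℝ) 1)), ∀ x, |φ s x| ≤ M)
    (hL0 : 0 < L) (hL : L < Real.pi ^ 2 / 4)
    (hLip : ∀ᵐ s ∂(volume.restrict (Ioo (0:ℝ) 1)), ∀ x y, |φ s x - φ s y| ≤ L * |x - y|) :
    ∃ (v : ℝ → ℝ) (hv : IntervalIntegrable (fun s => φ s (v s)) volume 0 1),
      ∀ t ∈ Icc (0 : ℝ) 1, (H1L.ofSource _ hv).f t = v t := by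
  obtain ⟨α, hLα, hα1⟩ : ∃ α, Real.sqrt L < α ∧ α < Real.pi / 2 := by
    refine exists_between ((Real.sqrt_lt' (by positivity)).2 ?_)
    linarith [show (Real.pi / 2) ^ 2 = Real.pi ^ 2 / 4 by ring]
  have hα0 : 0 < α := (Real.sqrt_nonneg L).trans_lt hLα
  have hLα2 : L < α ^ 2 := (Real.sqrt_lt' hα0).1 hLα
  set ψ : ℝ → ℝ := fun s => Real.cos (α * (1 - s)) with hψ
  have hψc : Continuous ψ := by fun_prop
  have hψpos : ∀ s ∈ Icc (0 : ℝ) 1, 0 < ψ s := fun s hs => cos_weight_pos hα0.le hα1 hs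
  let E : C(Icc (0 : ℝ) 1, ℝ) → ℝ → ℝ := fun u s => ψ s * IccExtend zero_le_one u s
  have hE : ∀ u, IntervalIntegrable (fun s => φ s (E u s)) volume 0 1 := fun u =>
    intervalIntegrable_superposition hmeas hM
      (hψc.mul (u.continuous.Icc_extend')).continuousOn
  let T : C(Icc (0 : ℝ) 1, ℝ) → C(Icc (0 : ℝ) 1, ℝ) := fun u =>
    ⟨fun t => (H1L.ofSource _ (hE u)).f t / ψ t, by
      refine Continuous.div ?_ (hψc.comp continuous_subtype_val) fun t => (hψpos t t.2).ne'
      have := (H1L.ofSource _ (hE u)).continuousOn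
      rw [uIcc_of_le zero_le_one] at this
      exact this.domRestrict⟩
  let q : NNReal := ⟨L / α ^ 2, by positivity⟩
  have hT : ContractingWith q T := by
    refine ⟨?_, LipschitzWith.of_dist_le_mul fun u w => ?_⟩
    · rw [← NNReal.coe_lt_coe]
      exact (div_lt_one (by positivity)).2 hLα2
    · rw [ContinuousMap.dist_le (by positivity)]
      intro t
      have key := H1L.abs_ofSource_sub_le (hE u) (hE w) hα0 hα1 (C := L * dist u w)
        (by positivity) ?_ t t.2
      · change |_ / ψ t - _ / ψ t| ≤ L / α ^ 2 * dist u w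
        rw [← sub_div, abs_div, abs_of_pos (hψpos t t.2), div_le_iff₀ (hψpos t t.2)]
        exact key.trans_eq (by simp only [hψ]; ring)
      · filter_upwards [ae_Ioc_of_ae_Ioo hLip] with s hs hsm
        refine (hs hsm _ _).trans ?_
        have hsm' : s ∈ Icc (0 : ℝ) 1 := Ioc_subset_Icc_self hsm
        have hd : |u ⟨s, hsm'⟩ - w ⟨s, hsm'⟩| ≤ dist u w :=
          (Real.dist_eq _ _).symm.trans_le (ContinuousMap.dist_apply_le_dist _)
        simp only [E, IccExtend_of_mem _ _ hsm']
        rw [← mul_sub, abs_mul, abs_of_pos (hψpos s hsm'), mul_assoc, mul_comm (ψ s)]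
        gcongr
        exact (hψpos s hsm').le
  set u := hT.fixedPoint T
  have hfix : T u = u := hT.fixedPoint_isFixedPt
  refine ⟨E u, hE u, fun t ht => ?_⟩
  have h := DFunLike.congr_fun hfix ⟨t, ht⟩
  change (H1L.ofSource _ (hE u)).f t / ψ t = u ⟨t, ht⟩ at h
  rw [div_eq_iff (hψpos t ht).ne'] at h
  rw [h]
  simp only [E, IccExtend_of_mem _ _ ht]
  ring

end Nonlinearity

/-- Lemma `qualit`: let `φ ∈ L^∞(I×ℝ)` be Lipschitz in its second
variable with constant `L ∈ (0, c_p⁻² = π²/4)`.  Then there is a unique weak solution `v`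
of `-v'' + φ(s,v) = 0`, `v(0)=0`, `v'(1)=0`, and it satisfies
`‖v‖ ≤ c_p/(1-Lc_p²)·‖φ(·,0)‖_∞` and `‖v‖_∞ ≤ ‖φ‖_∞`, with `c_p = 2/π`. -/
theorem exists_unique_weak_sol
    (φ : ℝ → ℝ → ℝ) (hmeas : Measurable (Function.uncurry φ))
    (M : ℝ) (hM : ∀ᵐ s ∂(volume.restrict (Ioo (0:ℝ) 1)), ∀ x, |φ s x| ≤ M)
    (L : ℝ) (hL0 : 0 < L) (hL : L < Real.pi ^ 2 / 4)
    (hLip : ∀ᵐ s ∂(volume.restrict (Ioo (0:ℝ) 1)),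
      ∀ x y, |φ s x - φ s y| ≤ L * |x - y|) :
    ∃ v : H1L, IsWeakSol φ v ∧
      (∀ w : H1L, IsWeakSol φ w → ∀ t ∈ Icc (0 : ℝ) 1, w.f t = v.f t) ∧
      (∀ M0 : ℝ, (∀ᵐ s ∂(volume.restrict (Ioo (0:ℝ) 1)), |φ s 0| ≤ M0) →
        Real.sqrt (∫ s in (0 : ℝ)..1, (v.f' s) ^ 2) ≤
          (2 / Real.pi) / (1 - L * (2 / Real.pi) ^ 2) * M0) ∧
      (∀ M' : ℝ, (∀ᵐ s ∂(volume.restrict (Ioo (0:ℝ) 1)), ∀ x, |φ s x| ≤ M') →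
        ∀ t ∈ Icc (0 : ℝ) 1, |v.f t| ≤ M') := by
  obtain ⟨u, hu, hfix⟩ := exists_fixedPoint hmeas hM hL0 hL hLip
  have hsol : IsWeakSol φ (H1L.ofSource _ hu) :=
    H1L.isWeakSol_ofSource hu fun s hs => by rw [hfix s hs]
  refine ⟨H1L.ofSource _ hu, hsol, fun w hw => hw.eq hmeas hM hL0 hL hLip hsol,
    fun C hC => hsol.energy_le hL0 hL hLip hC, fun C hC => ?_⟩
  refine H1L.abs_ofSource_le hu (nonneg_of_ae_Ioo hC fun s hs => (abs_nonneg _).trans (hs 0)) ?_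
  filter_upwards [ae_Ioc_of_ae_Ioo hC] with s hs hsm using hs hsm _
end

section
/- Consider the boundary value problem −ϑ'' − H sin ϑ = 0 in (0,1), ϑ(0)=0, ϑ'(1)=0, with parameter H > 0. For every H < π²/4 the only solution is the trivial one ϑ = 0, while for every H > π²/4 there exists a nontrivial, strictly increasing solution ϑ with ϑ(1)=ϑ₁ ∈ (0,π), where ϑ₁ is determined by the equation √(2H) = √2 · K(sin(ϑ₁/2)) and ϑ is given implicitly by ∫₀^{ϑ(s)} dt/√(cos t − cos ϑ₁) = √(2H) s; in particular, uniqueness of solutions is lost for H > π²/4. -/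
open Set

/-- The complete elliptic integral of the first kind,
`K(k) = ∫₀^{π/2} dφ/√(1 − k² sin²φ)`. -/
noncomputable def ellK (k : ℝ) : ℝ :=
  ∫ φ in (0 : ℝ)..(Real.pi / 2), 1 / Real.sqrt (1 - k ^ 2 * Real.sin φ ^ 2)

/-- A (classical) solution of `-ϑ'' − H sin ϑ = 0` in `(0,1)`, `ϑ(0) = 0`, `ϑ'(1) = 0`;
`θ'` records the derivative of `θ` on `[0,1]`. -/
def IsSol (H : ℝ) (θ θ' : ℝ → ℝ) : Prop :=
  θ 0 = 0 ∧ θ' 1 = 0 ∧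
  ∀ t ∈ Icc (0 : ℝ) 1,
    HasDerivWithinAt θ (θ' t) (Icc (0 : ℝ) 1) t ∧
    HasDerivWithinAt θ' (-H * Real.sin (θ t)) (Icc (0 : ℝ) 1) t

/-- Energy argument: with `g = √H tan(√H (1 - t))`, the function `g θ² - θ θ'` is nonincreasing and
vanishes at both endpoints. -/
lemma IsSol.eq_zero {H : ℝ} (hH0 : 0 < H) (hH : H < Real.pi ^ 2 / 4) {θ θ' : ℝ → ℝ}
    (h : IsSol H θ θ') : ∀ t ∈ Icc (0 : ℝ) 1, θ t = 0 := by
  obtain ⟨h0, h1, hd⟩ := h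
  set c := Real.sqrt H with hc
  have hc0 : 0 < c := Real.sqrt_pos.2 hH0
  have hcc : c ^ 2 = H := Real.sq_sqrt hH0.le
  have hcpi : c < Real.pi / 2 := by
    refine lt_of_pow_lt_pow_left₀ 2 (by positivity) ?_
    rw [hcc]; linarith
  have hcos : ∀ t ∈ Icc (0 : ℝ) 1, 0 < Real.cos (c * (1 - t)) := fun t ht => by
    apply Real.cos_pos_of_mem_Ioo
    constructor
    · nlinarith [ht.2, Real.pi_pos]
    · nlinarith [ht.1]
  set F : ℝ → ℝ := fun t => c * Real.tan (c * (1 - t)) * θ t ^ 2 - θ t * θ' t with hF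
  set F' : ℝ → ℝ := fun t => -H * (θ t * (θ t - Real.sin (θ t)))
    - (θ' t - c * Real.tan (c * (1 - t)) * θ t) ^ 2 with hF'
  have hFd : ∀ t ∈ Icc (0 : ℝ) 1, HasDerivWithinAt F (F' t) (Icc 0 1) t := fun t ht => by
    have hp := hcos t ht
    have hl : HasDerivAt (fun t : ℝ => c * (1 - t)) (-c) t := by
      simpa using ((hasDerivAt_id t).const_sub 1).const_mul c
    have ht1 := ((Real.hasDerivAt_tan hp.ne').comp t hl).const_mul c
    obtain ⟨ha, hb⟩ := hd t ht
    refine ((ht1.hasDerivWithinAt.mul (ha.pow 2)).sub (ha.mul hb)).congr_deriv ?_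
    have key : 1 / Real.cos (c * (1 - t)) ^ 2 = 1 + Real.tan (c * (1 - t)) ^ 2 := by
      rw [Real.tan_eq_sin_div_cos]
      field_simp
      rw [add_comm, Real.sin_sq_add_cos_sq]
    simp only [hF', key, Function.comp, Pi.pow_apply]
    rw [← hcc]
    push_cast
    ring
  have hmul : ∀ x : ℝ, 0 ≤ x * (x - Real.sin x) := fun x => by
    rcases le_total 0 x with hx | hx
    · exact mul_nonneg hx (sub_nonneg.2 (Real.sin_le hx))
    · exact mul_nonneg_of_nonpos_of_nonpos hx (sub_nonpos.2 (Real.le_sin hx))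
  have hneg : ∀ t, F' t ≤ 0 := fun t => by
    have := mul_nonneg hH0.le (hmul (θ t))
    have := sq_nonneg (θ' t - c * Real.tan (c * (1 - t)) * θ t)
    simp only [hF']; linarith
  have hanti : AntitoneOn F (Icc 0 1) :=
    antitoneOn_of_hasDerivWithinAt_nonpos (convex_Icc 0 1)
      (fun t ht => (hFd t ht).continuousWithinAt)
      (fun t ht => (hFd t (interior_subset ht)).mono interior_subset) (fun t _ => hneg t)
  have hzero : ∀ t ∈ Icc (0 : ℝ) 1, F t = 0 := fun t ht => by
    have e0 : F 0 = 0 := by simp [hF, h0]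
    have e1 : F 1 = 0 := by simp [hF, h1]
    have a := hanti (left_mem_Icc.2 zero_le_one) ht ht.1
    have b := hanti ht (right_mem_Icc.2 zero_le_one) ht.2
    linarith
  intro t ht
  have hd0 : HasDerivWithinAt F 0 (Icc 0 1) t :=
    (hasDerivWithinAt_const t (Icc (0 : ℝ) 1) (0 : ℝ)).congr hzero (hzero t ht)
  have hF0 : F' t = 0 := (uniqueDiffOn_Icc zero_lt_one t ht).eq_deriv _ (hFd t ht) hd0
  by_contra hne
  have hpos : 0 < θ t * (θ t - Real.sin (θ t)) := by
    rcases lt_or_gt_of_ne hne with hx | hx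
    · exact mul_pos_of_neg_of_neg hx (sub_neg.2 (Real.lt_sin hx))
    · exact mul_pos hx (sub_pos.2 (Real.sin_lt hx))
  have := mul_pos hH0 hpos
  have := sq_nonneg (θ' t - c * Real.tan (c * (1 - t)) * θ t)
  simp only [hF'] at hF0
  linarith

lemma one_sub_sq_le_one_sub_sq_mul_sin_sq (k φ : ℝ) :
    1 - k ^ 2 ≤ 1 - k ^ 2 * Real.sin φ ^ 2 := by
  nlinarith [mul_nonneg (sq_nonneg k) (sub_nonneg.2 (Real.sin_sq_le_one φ))]

lemma one_sub_sq_mul_sin_sq_pos {k : ℝ} (hk : k ^ 2 < 1) (φ : ℝ) :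
    0 < 1 - k ^ 2 * Real.sin φ ^ 2 :=
  (sub_pos.2 hk).trans_le (one_sub_sq_le_one_sub_sq_mul_sin_sq k φ)

lemma continuous_ellK_integrand {k : ℝ} (hk : k ^ 2 < 1) :
    Continuous fun φ : ℝ => 1 / Real.sqrt (1 - k ^ 2 * Real.sin φ ^ 2) :=
  continuous_const.div (by fun_prop)
    fun φ => (Real.sqrt_pos.2 (one_sub_sq_mul_sin_sq_pos hk φ)).ne'

lemma ellK_zero : ellK 0 = Real.pi / 2 := by
  simp [ellK]

lemma continuousOn_ellK {k₀ : ℝ} (hk₀ : k₀ < 1) : ContinuousOn ellK (Icc 0 k₀) := by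
  rcases lt_or_ge k₀ 0 with hneg | hnn
  · simp [Icc_eq_empty hneg.not_ge]
  have hε : 0 < 1 - k₀ ^ 2 := by nlinarith
  have hcont : Continuous fun k : ℝ => ∫ φ in (0 : ℝ)..(Real.pi / 2),
      1 / Real.sqrt (max (1 - k₀ ^ 2) (1 - k ^ 2 * Real.sin φ ^ 2)) := by
    apply intervalIntegral.continuous_parametric_intervalIntegral_of_continuous'
    refine continuous_const.div (by fun_prop) fun p => ?_
    exact (Real.sqrt_pos.2 (lt_max_of_lt_left hε)).ne'
  refine hcont.continuousOn.congr fun k hk => ?_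
  refine intervalIntegral.integral_congr fun φ _ => ?_
  have : k ^ 2 ≤ k₀ ^ 2 := pow_le_pow_left₀ hk.1 hk.2 2
  have := one_sub_sq_le_one_sub_sq_mul_sin_sq k φ
  rw [max_eq_right (by linarith)]

/-- The integrand of `K` dominates `1 / (ε + π/2 - φ)` where `ε = √(1 - k²)`. -/
lemma log_le_ellK {ε : ℝ} (hε : 0 < ε) (hε1 : ε ≤ 1) :
    Real.log (ε + Real.pi / 2) - Real.log ε ≤ ellK (Real.sqrt (1 - ε ^ 2)) := by
  have hsq : Real.sqrt (1 - ε ^ 2) ^ 2 = 1 - ε ^ 2 := Real.sq_sqrt (by nlinarith)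
  have hk : Real.sqrt (1 - ε ^ 2) ^ 2 < 1 := by rw [hsq]; nlinarith
  have hpi : 0 ≤ Real.pi / 2 := by positivity
  have hpos : ∀ x ∈ Icc 0 (Real.pi / 2), 0 < ε + Real.pi / 2 - x := fun x hx => by
    linarith [hx.2]
  have hcont : ContinuousOn (fun x => 1 / (ε + Real.pi / 2 - x)) (Icc 0 (Real.pi / 2)) :=
    continuousOn_const.div (by fun_prop) fun x hx => (hpos x hx).ne'
  have hint : IntervalIntegrable (fun x => 1 / (ε + Real.pi / 2 - x)) MeasureTheory.volume 0
      (Real.pi / 2) := by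
    apply ContinuousOn.intervalIntegrable
    rwa [uIcc_of_le hpi]
  have hval : ∫ x in (0 : ℝ)..(Real.pi / 2), 1 / (ε + Real.pi / 2 - x) =
      Real.log (ε + Real.pi / 2) - Real.log ε := by
    rw [intervalIntegral.integral_eq_sub_of_hasDerivAt
      (f := fun x => -Real.log (ε + Real.pi / 2 - x)) (fun x hx => ?_) hint]
    · simp only [add_sub_cancel_right, sub_zero]; ring
    · rw [uIcc_of_le hpi] at hx
      have := (((hasDerivAt_id x).const_sub (ε + Real.pi / 2)).log (hpos x hx).ne').neg
      refine this.congr_deriv ?_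
      simp [neg_div]
  rw [← hval]
  refine intervalIntegral.integral_mono_on hpi hint
    ((continuous_ellK_integrand hk).intervalIntegrable _ _) fun x hx => ?_
  refine one_div_le_one_div_of_le (Real.sqrt_pos.2 (one_sub_sq_mul_sin_sq_pos hk x)) ?_
  rw [Real.sqrt_le_left (hpos x hx).le, hsq]
  have h1 : Real.cos x ≤ Real.pi / 2 - x := by
    rw [← Real.sin_pi_div_two_sub]; exact Real.sin_le (by linarith [hx.2])
  have h0 : 0 ≤ Real.cos x := Real.cos_nonneg_of_mem_Icc ⟨by linarith [hx.1], hx.2⟩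
  nlinarith [Real.sin_sq_add_cos_sq x, Real.sin_sq_le_one x, mul_nonneg hε.le (h0.trans h1),
    mul_nonneg (sq_nonneg ε) (sq_nonneg (Real.cos x)), mul_self_le_mul_self h0 h1]

lemma exists_ellK_eq {y : ℝ} (hy : Real.pi / 2 < y) : ∃ k ∈ Ioo (0 : ℝ) 1, ellK k = y := by
  have hy0 : 0 < y := by linarith [Real.pi_pos]
  set ε := Real.exp (-y) with hεdef
  have hε : 0 < ε := Real.exp_pos _
  have hε1 : ε < 1 := Real.exp_lt_one_iff.2 (by linarith)
  have hk₀ : Real.sqrt (1 - ε ^ 2) < 1 := by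
    rw [Real.sqrt_lt' one_pos]; nlinarith
  have hge : y ≤ ellK (Real.sqrt (1 - ε ^ 2)) := by
    refine le_trans ?_ (log_le_ellK hε hε1.le)
    have : 0 ≤ Real.log (ε + Real.pi / 2) :=
      Real.log_nonneg (by linarith [Real.pi_gt_three])
    rw [hεdef, Real.log_exp]
    linarith
  obtain ⟨k, hk, hky⟩ := intermediate_value_Icc (Real.sqrt_nonneg _) (continuousOn_ellK hk₀)
    (show y ∈ Icc _ _ from ⟨by rw [ellK_zero]; exact hy.le, hge⟩)
  refine ⟨k, ⟨lt_of_le_of_ne hk.1 ?_, hk.2.trans_lt hk₀⟩, hky⟩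
  rintro rfl
  rw [ellK_zero] at hky
  linarith

/-- The Jacobi amplitude: the inverse of the incomplete elliptic integral of the first kind. -/
lemma exists_amplitude {k : ℝ} (hk : k ^ 2 < 1) :
    ∃ am : ℝ → ℝ, StrictMono am ∧ am 0 = 0 ∧ am (ellK k) = Real.pi / 2 ∧
      ∀ x, HasDerivAt am (Real.sqrt (1 - k ^ 2 * Real.sin (am x) ^ 2)) x := by
  set f : ℝ → ℝ := fun φ => 1 / Real.sqrt (1 - k ^ 2 * Real.sin φ ^ 2) with hf
  have hfc : Continuous f := continuous_ellK_integrand hk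
  set u : ℝ → ℝ := fun x => ∫ φ in (0 : ℝ)..x, f φ with hu
  have hsqrt : ∀ x, 0 < Real.sqrt (1 - k ^ 2 * Real.sin x ^ 2) := fun x =>
    Real.sqrt_pos.2 (one_sub_sq_mul_sin_sq_pos hk x)
  have hud : ∀ x, HasDerivAt u (f x) x := fun x =>
    intervalIntegral.integral_hasDerivAt_right (hfc.intervalIntegrable _ _)
      hfc.stronglyMeasurable.stronglyMeasurableAtFilter hfc.continuousAt
  have hf1 : ∀ x, 1 ≤ f x := fun x => by
    rw [hf, one_le_div (hsqrt x), Real.sqrt_le_one]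
    nlinarith [mul_nonneg (sq_nonneg k) (sq_nonneg (Real.sin x))]
  have hmono : StrictMono u := strictMono_of_hasDerivAt_pos hud fun x => by linarith [hf1 x]
  have hmono' : Monotone fun x => u x - x :=
    monotone_of_hasDerivAt_nonneg (fun x => (hud x).sub (hasDerivAt_id x))
      fun x => sub_nonneg.2 (hf1 x)
  have hu0 : u 0 = 0 := by simp [hu]
  have hsurj : Function.Surjective u := by
    refine Continuous.surjective
      (continuous_iff_continuousAt.2 fun x => (hud x).continuousAt) ?_ ?_
    · refine Filter.tendsto_atTop_mono' _ ?_ Filter.tendsto_id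
      filter_upwards [Filter.eventually_ge_atTop 0] with x hx
      have := hmono' hx
      simp only [hu0, id] at *; linarith
    · refine Filter.tendsto_atBot_mono' _ ?_ Filter.tendsto_id
      filter_upwards [Filter.eventually_le_atBot 0] with x hx
      have := hmono' hx
      simp only [hu0, id] at *; linarith
  let e : ℝ ≃o ℝ := hmono.orderIsoOfSurjective u hsurj
  have he : ∀ x, e x = u x := fun x => rfl
  refine ⟨e.symm, e.symm.strictMono, ?_, ?_, fun x => ?_⟩
  · rw [OrderIso.symm_apply_eq, he, hu0]
  · rw [OrderIso.symm_apply_eq, he]; rfl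
  · have := HasDerivAt.of_local_left_inverse (f := u) (g := e.symm) (a := x)
      e.symm.continuous.continuousAt (hud _) (by linarith [hf1 (e.symm x)])
      (Filter.Eventually.of_forall fun y => e.apply_symm_apply y)
    refine this.congr_deriv ?_
    simp [hf]

/-- Change of variables in the time map of a strictly increasing solution. -/
lemma integral_inv_eq_mul {θ θ' g : ℝ → ℝ} {C s : ℝ} (hs : s ∈ Icc (0 : ℝ) 1) (h0 : θ 0 = 0)
    (hmono : StrictMonoOn θ (Icc 0 1))
    (hd : ∀ t ∈ Icc (0 : ℝ) 1, HasDerivWithinAt θ (θ' t) (Icc 0 1) t)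
    (hg : ∀ t ∈ Ico (0 : ℝ) 1, θ' t * g (θ t) = C) :
    ∫ t in (0 : ℝ)..(θ s), g t = C * s := by
  have hsub : Icc 0 s ⊆ Icc (0 : ℝ) 1 := Icc_subset_Icc_right hs.2
  have hθs : 0 ≤ θ s := by
    rw [← h0]; exact hmono.monotoneOn (left_mem_Icc.2 zero_le_one) hs hs.1
  have himg : θ '' Icc 0 s = Icc 0 (θ s) := by
    apply Subset.antisymm
    · rintro _ ⟨t, ht, rfl⟩
      refine ⟨?_, hmono.monotoneOn (hsub ht) hs ht.2⟩
      rw [← h0]; exact hmono.monotoneOn (left_mem_Icc.2 zero_le_one) (hsub ht) ht.1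
    · have := intermediate_value_Icc hs.1
        (f := θ) fun t ht => ((hd t (hsub ht)).continuousWithinAt).mono hsub
      rwa [h0] at this
  rw [intervalIntegral.integral_of_le hθs, ← MeasureTheory.integral_Icc_eq_integral_Ioc, ← himg,
    MeasureTheory.integral_image_eq_integral_deriv_smul_of_monotoneOn measurableSet_Icc
      (fun t ht => (hd t (hsub ht)).mono hsub) (hmono.monotoneOn.mono hsub),
    MeasureTheory.integral_Icc_eq_integral_Ico,
    MeasureTheory.setIntegral_congr_fun measurableSet_Ico (f := fun t => θ' t • g (θ t))
      (g := fun _ => C) fun t ht => hg t ⟨ht.1, ht.2.trans_le hs.2⟩]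
  simp [hs.1, mul_comm]

lemma exists_strictMonoOn_isSol {H : ℝ} (hH : Real.pi ^ 2 / 4 < H) :
    ∃ θ θ' : ℝ → ℝ, ∃ θ₁ : ℝ, IsSol H θ θ' ∧
      StrictMonoOn θ (Icc (0 : ℝ) 1) ∧
      θ 1 = θ₁ ∧ θ₁ ∈ Ioo (0 : ℝ) Real.pi ∧
      Real.sqrt (2 * H) = Real.sqrt 2 * ellK (Real.sin (θ₁ / 2)) ∧
      (∀ s ∈ Icc (0 : ℝ) 1,
        (∫ t in (0 : ℝ)..(θ s), 1 / Real.sqrt (Real.cos t - Real.cos θ₁)) =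
          Real.sqrt (2 * H) * s) ∧
      θ 1 ≠ 0 := by
  have hH0 : 0 < H := lt_trans (by positivity) hH
  set c := Real.sqrt H with hc
  have hc0 : 0 < c := Real.sqrt_pos.2 hH0
  have hcc : c ^ 2 = H := Real.sq_sqrt hH0.le
  have hcpi : Real.pi / 2 < c := Real.lt_sqrt_of_sq_lt (by linarith)
  obtain ⟨k, ⟨hk0, hk1⟩, hkc⟩ := exists_ellK_eq hcpi
  have hk : k ^ 2 < 1 := by nlinarith
  obtain ⟨am, ham, ham0, hamK, hamd⟩ := exists_amplitude hk
  rw [hkc] at hamK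
  set p : ℝ → ℝ := fun t => am (c * t) with hp
  set Δ : ℝ → ℝ := fun t => Real.sqrt (1 - k ^ 2 * Real.sin (p t) ^ 2) with hΔ
  have hΔpos : ∀ t, 0 < Δ t := fun t => Real.sqrt_pos.2 (one_sub_sq_mul_sin_sq_pos hk _)
  have hp0 : p 0 = 0 := by simp [hp, ham0]
  have hp1 : p 1 = Real.pi / 2 := by simp [hp, hamK]
  have hpmono : StrictMono p := fun a b hab => ham (by gcongr)
  have hpmem : ∀ t ∈ Icc (0 : ℝ) 1, p t ∈ Icc 0 (Real.pi / 2) := fun t ht =>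
    ⟨hp0 ▸ hpmono.monotone ht.1, hp1 ▸ hpmono.monotone ht.2⟩
  have hpd : ∀ t, HasDerivAt p (c * Δ t) t := fun t => by
    have := (hamd (c * t)).comp t ((hasDerivAt_id t).const_mul c)
    refine this.congr_deriv ?_
    simp only [hΔ, hp, mul_one]; ring
  have hks : ∀ t, k * Real.sin (p t) ∈ Ioo (-1 : ℝ) 1 := fun t => by
    rw [mem_Ioo, ← abs_lt, abs_mul, abs_of_pos hk0]
    nlinarith [Real.abs_sin_le_one (p t)]
  set θ : ℝ → ℝ := fun t => 2 * Real.arcsin (k * Real.sin (p t)) with hθ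
  set θ' : ℝ → ℝ := fun t => 2 * k * c * Real.cos (p t) with hθ'
  have hsinhalf : ∀ t, Real.sin (θ t / 2) = k * Real.sin (p t) := fun t => by
    simp only [hθ]
    rw [mul_div_cancel_left₀ _ two_ne_zero, Real.sin_arcsin (hks t).1.le (hks t).2.le]
  have hcoshalf : ∀ t, Real.cos (θ t / 2) = Δ t := fun t => by
    simp only [hθ]
    rw [mul_div_cancel_left₀ _ two_ne_zero, Real.cos_arcsin, mul_pow]
  have hsin : ∀ t, Real.sin (θ t) = 2 * (k * Real.sin (p t)) * Δ t := fun t => by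
    rw [← hsinhalf, ← hcoshalf, ← Real.sin_two_mul, mul_div_cancel₀ _ two_ne_zero]
  have hcos : ∀ t, Real.cos (θ t) = 1 - 2 * (k * Real.sin (p t)) ^ 2 := fun t => by
    rw [← hsinhalf, ← Real.cos_two_mul_eq_one_sub, mul_div_cancel₀ _ two_ne_zero]
  have hθd : ∀ t, HasDerivAt θ (θ' t) t := fun t => by
    have h1 := (Real.hasDerivAt_arcsin (hks t).1.ne' (hks t).2.ne).comp t
      (((hpd t).sin).const_mul k)
    refine (h1.const_mul 2).congr_deriv ?_
    have hne := (hΔpos t).ne'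
    have : Real.sqrt (1 - (k * Real.sin (p t)) ^ 2) = Δ t := by simp only [hΔ, mul_pow]
    rw [this]
    simp only [hθ']
    field_simp
  have hθd' : ∀ t, HasDerivAt θ' (-H * Real.sin (θ t)) t := fun t => by
    refine (((hpd t).cos).const_mul (2 * k * c)).congr_deriv ?_
    rw [hsin, ← hcc]; ring
  have hmono : StrictMonoOn θ (Icc 0 1) := fun a ha b hb hab => by
    have hpa := hpmem a ha
    have hpb := hpmem b hb
    have hs : Real.sin (p a) < Real.sin (p b) :=
      Real.sin_lt_sin_of_lt_of_le_pi_div_two (by linarith [hpa.1, Real.pi_pos]) hpb.2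
        (hpmono hab)
    have := Real.strictMonoOn_arcsin (Ioo_subset_Icc_self (hks a)) (Ioo_subset_Icc_self (hks b))
      (mul_lt_mul_of_pos_left hs hk0)
    simp only [hθ]; linarith
  have hθ0 : θ 0 = 0 := by simp [hθ, hp0]
  have hθ1 : θ 1 = 2 * Real.arcsin k := by simp [hθ, hp1]
  have hθ1pos : 0 < θ 1 := by rw [hθ1]; linarith [Real.arcsin_pos.2 hk0]
  have hsq : Real.sqrt (2 * H) = Real.sqrt 2 * c := Real.sqrt_mul (by norm_num) H
  refine ⟨θ, θ', θ 1, ⟨hθ0, by simp [hθ', hp1], fun t _ =>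
    ⟨(hθd t).hasDerivWithinAt, (hθd' t).hasDerivWithinAt⟩⟩, hmono, rfl, ⟨hθ1pos, ?_⟩, ?_, ?_,
    hθ1pos.ne'⟩
  · rw [hθ1]; linarith [Real.arcsin_lt_pi_div_two.2 hk1]
  · rw [hsinhalf, hp1, Real.sin_pi_div_two, mul_one, hkc, hsq]
  · intro s hs
    refine integral_inv_eq_mul hs hθ0 hmono (fun t _ => (hθd t).hasDerivWithinAt) fun t ht => ?_
    have hcpos : 0 < Real.cos (p t) := Real.cos_pos_of_mem_Ioo
      ⟨by linarith [(hpmem t (Ico_subset_Icc_self ht)).1, Real.pi_pos], hp1 ▸ hpmono ht.2⟩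
    have hdiff : Real.cos (θ t) - Real.cos (θ 1) = 2 * (k * Real.cos (p t)) ^ 2 := by
      rw [hcos, hcos, hp1, Real.sin_pi_div_two]
      linear_combination -2 * k ^ 2 * Real.sin_sq_add_cos_sq (p t)
    rw [hdiff, Real.sqrt_mul (by norm_num), Real.sqrt_sq (by positivity), hsq]
    have h2 : Real.sqrt 2 ^ 2 = 2 := Real.sq_sqrt (by norm_num)
    have h20 : 0 < Real.sqrt 2 := by positivity
    simp only [hθ']
    field_simp
    rw [h2]

/-- Remark `lyasch`: for `0 < H < π²/4` the only solution of the
cantilever problem `-ϑ'' − H sin ϑ = 0`, `ϑ(0)=0`, `ϑ'(1)=0` is the trivial one, while for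
`H > π²/4` there is a nontrivial strictly increasing solution with `ϑ(1) = ϑ₁ ∈ (0,π)`,
`√(2H) = √2·K(sin(ϑ₁/2))`, given implicitly by
`∫₀^{ϑ(s)} dt/√(cos t − cos ϑ₁) = √(2H)·s`; in particular uniqueness is lost. -/
theorem elastica_bifurcation :
    (∀ H : ℝ, 0 < H → H < Real.pi ^ 2 / 4 →
      ∀ θ θ' : ℝ → ℝ, IsSol H θ θ' → ∀ t ∈ Icc (0 : ℝ) 1, θ t = 0) ∧
    (∀ H : ℝ, Real.pi ^ 2 / 4 < H →
      ∃ θ θ' : ℝ → ℝ, ∃ θ₁ : ℝ, IsSol H θ θ' ∧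
        StrictMonoOn θ (Icc (0 : ℝ) 1) ∧
        θ 1 = θ₁ ∧ θ₁ ∈ Ioo (0 : ℝ) Real.pi ∧
        Real.sqrt (2 * H) = Real.sqrt 2 * ellK (Real.sin (θ₁ / 2)) ∧
        (∀ s ∈ Icc (0 : ℝ) 1,
          (∫ t in (0 : ℝ)..(θ s), 1 / Real.sqrt (Real.cos t - Real.cos θ₁)) =
            Real.sqrt (2 * H) * s) ∧
        θ 1 ≠ 0) := by
  exact ⟨fun H hH0 hH _ _ h => h.eq_zero hH0 hH, fun H hH => exists_strictMonoOn_isSol hH⟩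
end

section
/- Let ϑ̄ ∈ C([0,1])ⁿ, ε > 0, 0 < K < π²/4, and for α ∈ C([0,1]) let h(α) ∈ D be the unique fixed point of T^{(α)} (existing for γ > γ₁), with associated states ϑ_i(α) and multipliers λ_i(α). Define A : C([0,1]) → C([0,1]) as the unique solution of −A(α)'' = −(1/ε)Σ_{i=1}^n λ_i(α) h_i(α)·D²m(α+ϑ_i(α)) in (0,1), A(α)(0)=0, A(α)'(1)=0. Then there exists γ* > γ₁ (depending on ϑ̄, K, and ε) such that for every γ > γ* the map A is a contraction on C([0,1]) with respect to the sup norm, and hence has a unique fixed point α = A(α); moreover α ∈ C²([0,1]) and α(0)=α'(1)=0. -/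
open MeasureTheory Set

noncomputable def edot (p q : ℝ × ℝ) : ℝ := p.1 * q.1 + p.2 * q.2
noncomputable def enorm2 (p : ℝ × ℝ) : ℝ := Real.sqrt (p.1 ^ 2 + p.2 ^ 2)
noncomputable def Dmvec (v : ℝ) : ℝ × ℝ := (-Real.sin v, Real.cos v)
noncomputable def D2mvec (v : ℝ) : ℝ × ℝ := (-Real.cos v, -Real.sin v)

noncomputable def mu01 : Measure ℝ := volume.restrict (Ioo 0 1)

/-- `H^1_{0L}(I)` modelled isometrically by the `L²(I)` space of derivatives. -/
noncomputable abbrev E := Lp ℝ 2 mu01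

noncomputable def U (g : E) : ℝ → ℝ := fun t => ∫ s in Ioc 0 t, (g : ℝ → ℝ) s ∂mu01

/-- Weak solution of the state equation `(P_ϑ)` with design the raw function `α`. -/
def IsStateSolF (α : ℝ → ℝ) (p : ℝ × ℝ) (g : E) : Prop :=
  ∀ w : E, (∫ s, (g : ℝ → ℝ) s * (w : ℝ → ℝ) s ∂mu01)
    - (∫ s, edot p (Dmvec (α s + U g s)) * U w s ∂mu01) = 0

/-- Weak solution of the adjoint equation `(P_λ)`. -/
def IsAdjSolF (α : ℝ → ℝ) (p : ℝ × ℝ) (g : E) (tbi : ℝ → ℝ) (l : E) : Prop :=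
  ∀ w : E, (∫ s, (l : ℝ → ℝ) s * (w : ℝ → ℝ) s ∂mu01)
    - (∫ s, U l s * edot p (D2mvec (α s + U g s)) * U w s ∂mu01)
    = ∫ s, (U g s - tbi s) * U w s ∂mu01

/-- The value `T_i^{(α)}(h) = −(1/γ)∫₀¹ λᵢ Dm(α+ϑᵢ)` of the chain map. -/
noncomputable def Tval (γ : ℝ) (α : ℝ → ℝ) (g l : E) : ℝ × ℝ :=
  (-(1 / γ) * ∫ s, U l s * (Dmvec (α s + U g s)).1 ∂mu01,
   -(1 / γ) * ∫ s, U l s * (Dmvec (α s + U g s)).2 ∂mu01)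

instance mu01_isProbabilityMeasure : IsProbabilityMeasure mu01 :=
  ⟨by simp [mu01]⟩

lemma abs_edot_Dmvec_le (p : ℝ × ℝ) (a : ℝ) : |edot p (Dmvec a)| ≤ enorm2 p := by
  refine Real.abs_le_sqrt ?_
  simp only [edot, Dmvec]
  nlinarith [Real.sin_sq_add_cos_sq a, sq_nonneg (p.1 * Real.cos a + p.2 * Real.sin a)]

lemma abs_edot_D2mvec_le (p : ℝ × ℝ) (a : ℝ) : |edot p (D2mvec a)| ≤ enorm2 p := by
  refine Real.abs_le_sqrt ?_
  simp only [edot, D2mvec]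
  nlinarith [Real.sin_sq_add_cos_sq a, sq_nonneg (p.1 * Real.sin a - p.2 * Real.cos a)]

lemma hasDerivAt_edot_Dmvec (p : ℝ × ℝ) (a : ℝ) :
    HasDerivAt (fun v => edot p (Dmvec v)) (edot p (D2mvec a)) a := by
  simp only [edot, Dmvec, D2mvec]
  exact ((Real.hasDerivAt_sin a).neg.const_mul p.1).add ((Real.hasDerivAt_cos a).const_mul p.2)

lemma hasDerivAt_edot_D2mvec (p : ℝ × ℝ) (a : ℝ) :
    HasDerivAt (fun v => edot p (D2mvec v)) (-edot p (Dmvec a)) a := by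
  simp only [edot, Dmvec, D2mvec]
  refine (((Real.hasDerivAt_cos a).neg.const_mul p.1).add
    ((Real.hasDerivAt_sin a).neg.const_mul p.2)).congr_deriv ?_
  ring

lemma abs_edot_Dmvec_sub_le (p : ℝ × ℝ) (a b : ℝ) :
    |edot p (Dmvec a) - edot p (Dmvec b)| ≤ enorm2 p * |a - b| :=
  convex_univ.norm_image_sub_le_of_norm_hasDerivWithin_le
    (fun x _ => (hasDerivAt_edot_Dmvec p x).hasDerivWithinAt)
    (fun x _ => abs_edot_D2mvec_le p x) (mem_univ b) (mem_univ a)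

lemma abs_edot_D2mvec_sub_le (p : ℝ × ℝ) (a b : ℝ) :
    |edot p (D2mvec a) - edot p (D2mvec b)| ≤ enorm2 p * |a - b| :=
  convex_univ.norm_image_sub_le_of_norm_hasDerivWithin_le
    (fun x _ => (hasDerivAt_edot_D2mvec p x).hasDerivWithinAt)
    (fun x _ => by simpa using abs_edot_Dmvec_le p x) (mem_univ b) (mem_univ a)

lemma continuous_edot_Dmvec (p : ℝ × ℝ) : Continuous fun v => edot p (Dmvec v) :=
  continuous_iff_continuousAt.2 fun a => (hasDerivAt_edot_Dmvec p a).continuousAt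

lemma continuous_edot_D2mvec (p : ℝ × ℝ) : Continuous fun v => edot p (D2mvec v) :=
  continuous_iff_continuousAt.2 fun a => (hasDerivAt_edot_D2mvec p a).continuousAt

lemma edot_sub_left (p q r : ℝ × ℝ) : edot (p - q) r = edot p r - edot q r := by
  simp only [edot, Prod.fst_sub, Prod.snd_sub]; ring

lemma enorm2_nonneg (p : ℝ × ℝ) : 0 ≤ enorm2 p := Real.sqrt_nonneg _

lemma enorm2_le_abs_add_abs (p : ℝ × ℝ) : enorm2 p ≤ |p.1| + |p.2| := by
  refine Real.sqrt_le_iff.2 ⟨by positivity, ?_⟩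
  nlinarith [sq_abs p.1, sq_abs p.2, mul_nonneg (abs_nonneg p.1) (abs_nonneg p.2)]

lemma eq_zero_of_enorm2_eq_zero {p : ℝ × ℝ} (h : enorm2 p = 0) : p = 0 := by
  have := (Real.sqrt_eq_zero (by positivity)).1 h
  ext
  · exact pow_eq_zero_iff two_ne_zero |>.1 (by nlinarith [sq_nonneg p.1, sq_nonneg p.2])
  · exact pow_eq_zero_iff two_ne_zero |>.1 (by nlinarith [sq_nonneg p.1, sq_nonneg p.2])

lemma integrable_mu01_of_continuousOn {f : ℝ → ℝ} (hf : ContinuousOn f (Icc 0 1)) :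
    Integrable f mu01 :=
  (hf.integrableOn_Icc (μ := volume)).mono_set Ioo_subset_Icc_self

lemma integrable_coe (g : E) : Integrable (g : ℝ → ℝ) mu01 :=
  (Lp.memLp g).integrable (by norm_num)

lemma U_sub (g g' : E) (t : ℝ) : U (g - g') t = U g t - U g' t := by
  unfold U
  rw [← integral_sub (integrable_coe g).integrableOn (integrable_coe g').integrableOn]
  exact integral_congr_ae (ae_restrict_of_ae (Lp.coeFn_sub g g'))

lemma integral_abs_le_norm (g : E) : ∫ s, |(g : ℝ → ℝ) s| ∂mu01 ≤ ‖g‖ := by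
  have h := eLpNorm_le_eLpNorm_of_exponent_le (p := 1) (q := 2) (μ := mu01)
    (by norm_num) (Lp.aestronglyMeasurable g)
  rw [Lp.norm_def]
  have h2 := ENNReal.toReal_mono (Lp.eLpNorm_ne_top g) h
  rw [eLpNorm_one_eq_lintegral_enorm, ← integral_norm_eq_lintegral_enorm
    (Lp.aestronglyMeasurable g)] at h2
  exact h2

lemma abs_U_le (g : E) (t : ℝ) : |U g t| ≤ ‖g‖ := by
  refine le_trans ?_ (integral_abs_le_norm g)
  refine (abs_integral_le_integral_abs).trans ?_
  exact setIntegral_le_integral (integrable_coe g).abs (.of_forall fun s => abs_nonneg _)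

lemma continuous_U (g : E) : Continuous (U g) := by
  have h : U g = (fun t => ∫ s in (0:ℝ)..t, (g : ℝ → ℝ) s ∂mu01) ∘ fun t => max 0 t := by
    ext t
    rcases le_total 0 t with ht | ht
    · simp [U, ht, intervalIntegral.integral_of_le]
    · simp [U, ht]
  rw [h]
  have : NullSingletonClass mu01 := by unfold mu01; infer_instance
  exact (intervalIntegral.continuous_primitive
    (fun a b => (integrable_coe g).intervalIntegrable) 0).comp (by fun_prop)

lemma inner_eq_integral_mul (g w : E) :
    inner ℝ g w = ∫ s, (g : ℝ → ℝ) s * (w : ℝ → ℝ) s ∂mu01 := by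
  rw [L2.inner_def]
  refine integral_congr_ae (.of_forall fun s => ?_)
  simp [mul_comm]

lemma lintegral_cos_Ioc {t : ℝ} (h0 : 0 ≤ t) (h1 : t ≤ 1) :
    ∫⁻ s in Ioc 0 t, ENNReal.ofReal (Real.cos (Real.pi / 2 * s)) =
      ENNReal.ofReal (2 / Real.pi * Real.sin (Real.pi / 2 * t)) := by
  have hπ := Real.pi_pos
  rw [← ofReal_integral_eq_lintegral_ofReal, ← intervalIntegral.integral_of_le h0]
  · congr 1
    rw [intervalIntegral.integral_comp_mul_left (fun x => Real.cos x) (by positivity)]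
    simp
  · exact (by fun_prop : Continuous fun s => Real.cos (Real.pi / 2 * s)).integrableOn_Ioc
  · refine (ae_restrict_iff' measurableSet_Ioc).2 (.of_forall fun s hs => ?_)
    exact Real.cos_nonneg_of_neg_pi_div_two_le_of_le (by nlinarith [hs.1]) (by nlinarith [hs.2])

lemma lintegral_sin_Ico {s : ℝ} (h0 : 0 ≤ s) (h1 : s ≤ 1) :
    ∫⁻ t in Ico s 1, ENNReal.ofReal (2 / Real.pi * Real.sin (Real.pi / 2 * t)) =
      ENNReal.ofReal (4 / Real.pi ^ 2 * Real.cos (Real.pi / 2 * s)) := by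
  have hπ := Real.pi_pos
  rw [← ofReal_integral_eq_lintegral_ofReal, integral_Ico_eq_integral_Ioc,
    ← intervalIntegral.integral_of_le h1]
  · congr 1
    rw [intervalIntegral.integral_const_mul,
      intervalIntegral.integral_comp_mul_left (fun x => Real.sin x) (by positivity)]
    simp
    field_simp
    ring
  · exact (by fun_prop : Continuous fun s =>
      2 / Real.pi * Real.sin (Real.pi / 2 * s)).integrableOn_Icc.mono_set Ico_subset_Icc_self
  · refine (ae_restrict_iff' measurableSet_Ico).2 (.of_forall fun t ht => ?_)
    exact mul_nonneg (by positivity) (Real.sin_nonneg_of_nonneg_of_le_pi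
      (by nlinarith [ht.1]) (by nlinarith [ht.2]))

lemma ENNReal.sq_lintegral_le {X : Type*} [MeasurableSpace X] {μ : Measure X} {f : X → ENNReal}
    {c : X → ℝ} (hf : Measurable f) (hc : Measurable c) (hpos : ∀ᵐ x ∂μ, 0 < c x) :
    (∫⁻ x, f x ∂μ) ^ 2 ≤
      (∫⁻ x, f x ^ 2 / ENNReal.ofReal (c x) ∂μ) * ∫⁻ x, ENNReal.ofReal (c x) ∂μ := by
  have hsq : ∀ x, 0 < c x →
      ENNReal.ofReal (Real.sqrt (c x)) ^ 2 = ENNReal.ofReal (c x) := fun x hx => by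
    rw [← ENNReal.ofReal_pow (Real.sqrt_nonneg _), Real.sq_sqrt hx.le]
  have key := ENNReal.lintegral_mul_le_Lp_mul_Lq μ Real.HolderConjugate.two_two
    (f := fun x => f x / ENNReal.ofReal (Real.sqrt (c x)))
    (g := fun x => ENNReal.ofReal (Real.sqrt (c x)))
    (by fun_prop) (by fun_prop)
  have e1 : ∫⁻ x, f x ∂μ = ∫⁻ x, ((fun x => f x / ENNReal.ofReal (Real.sqrt (c x))) *
      fun x => ENNReal.ofReal (Real.sqrt (c x))) x ∂μ := by
    refine lintegral_congr_ae (hpos.mono fun x hx => ?_)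
    simp only [Pi.mul_apply]
    rw [ENNReal.div_mul_cancel (by simpa using hx) ENNReal.ofReal_ne_top]
  have e2 : ∫⁻ x, (f x / ENNReal.ofReal (Real.sqrt (c x))) ^ (2:ℝ) ∂μ =
      ∫⁻ x, f x ^ 2 / ENNReal.ofReal (c x) ∂μ := by
    refine lintegral_congr_ae (hpos.mono fun x hx => ?_)
    simp only [ENNReal.rpow_two, ← hsq x hx, ENNReal.div_eq_inv_mul, mul_pow, ENNReal.inv_pow]
  have e3 : ∫⁻ x, ENNReal.ofReal (Real.sqrt (c x)) ^ (2:ℝ) ∂μ =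
      ∫⁻ x, ENNReal.ofReal (c x) ∂μ := by
    refine lintegral_congr_ae (hpos.mono fun x hx => ?_)
    simp only [ENNReal.rpow_two, hsq x hx]
  rw [← e1, e2, e3] at key
  calc (∫⁻ x, f x ∂μ) ^ 2 ≤ _ := pow_le_pow_left' key 2
    _ = _ := by
      rw [mul_pow, ← ENNReal.rpow_two, ← ENNReal.rpow_two, ← ENNReal.rpow_mul,
        ← ENNReal.rpow_mul]
      norm_num

lemma cos_pi_div_two_mul_pos {s : ℝ} (hs : s ∈ Ioo (0:ℝ) 1) : 0 < Real.cos (Real.pi / 2 * s) :=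
  Real.cos_pos_of_mem_Ioo ⟨by nlinarith [hs.1, Real.pi_pos], by nlinarith [hs.2, Real.pi_pos]⟩

/-- Hardy-type inequality with the sharp constant, by a Schur test with weight `cos (π s / 2)`. -/
lemma lintegral_sq_lintegral_le {f : ℝ → ENNReal} (hf : Measurable f) :
    ∫⁻ t, (∫⁻ s in Ioc 0 t, f s ∂mu01) ^ 2 ∂mu01 ≤
      ENNReal.ofReal (4 / Real.pi ^ 2) * ∫⁻ s, f s ^ 2 ∂mu01 := by
  have hae : ∀ᵐ s ∂mu01, s ∈ Ioo (0:ℝ) 1 := ae_restrict_mem measurableSet_Ioo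
  set c : ℝ → ℝ := fun s => Real.cos (Real.pi / 2 * s) with hc
  set S : ℝ → ENNReal := fun t => ENNReal.ofReal (2 / Real.pi * Real.sin (Real.pi / 2 * t)) with hS
  have hcm : Measurable c := by fun_prop
  have hSm : Measurable S := by fun_prop
  set q : ℝ → ENNReal := fun s => f s ^ 2 / ENNReal.ofReal (c s) with hq
  have hqm : Measurable q := by fun_prop
  have hset : MeasurableSet {z : ℝ × ℝ | z.2 ∈ Ioc 0 z.1} :=
    (measurableSet_lt measurable_const measurable_snd).inter
      (measurableSet_le measurable_snd measurable_fst)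
  calc ∫⁻ t, (∫⁻ s in Ioc 0 t, f s ∂mu01) ^ 2 ∂mu01
      ≤ ∫⁻ t, (∫⁻ s, (Ioc 0 t).indicator q s * S t ∂mu01) ∂mu01 := by
        refine lintegral_mono_ae (hae.mono fun t ht => ?_)
        refine (ENNReal.sq_lintegral_le hf hcm
          (ae_restrict_of_ae (hae.mono fun s hs => cos_pi_div_two_mul_pos hs))).trans ?_
        rw [lintegral_mul_const _ (hqm.indicator measurableSet_Ioc),
          lintegral_indicator measurableSet_Ioc]
        gcongr
        refine le_trans ?_ (lintegral_cos_Ioc ht.1.le ht.2.le).le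
        exact lintegral_mono' (Measure.restrict_mono le_rfl Measure.restrict_le_self) le_rfl
    _ = ∫⁻ s, (∫⁻ t, (Ioc 0 t).indicator q s * S t ∂mu01) ∂mu01 := by
        refine lintegral_lintegral_swap (Measurable.aemeasurable ?_)
        refine Measurable.mul ?_ (hSm.comp measurable_fst)
        exact (hqm.comp measurable_snd).indicator hset
    _ ≤ ∫⁻ s, ENNReal.ofReal (4 / Real.pi ^ 2) * f s ^ 2 ∂mu01 := by
        refine lintegral_mono_ae (hae.mono fun s hs => ?_)
        have hcs := cos_pi_div_two_mul_pos hs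
        have e : ∀ t ∈ Ioo (0:ℝ) 1, (Ioc 0 t).indicator q s * S t =
            q s * (Ico s 1).indicator S t := fun t ht => by
          by_cases hst : s ≤ t
          · rw [indicator_of_mem (show s ∈ Ioc 0 t from ⟨hs.1, hst⟩),
              indicator_of_mem (show t ∈ Ico s 1 from ⟨hst, ht.2⟩)]
          · rw [indicator_of_notMem (fun h => hst h.2), indicator_of_notMem (fun h => hst h.1)]
            simp
        rw [lintegral_congr_ae (hae.mono e), lintegral_const_mul _ (hSm.indicator measurableSet_Ico),
          lintegral_indicator measurableSet_Ico]
        have hle : ∫⁻ t in Ico s 1, S t ∂mu01 ≤ ENNReal.ofReal (4 / Real.pi ^ 2 * c s) := by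
          refine le_trans ?_ (lintegral_sin_Ico hs.1.le hs.2.le).le
          exact lintegral_mono' (Measure.restrict_mono le_rfl Measure.restrict_le_self) le_rfl
        refine (mul_le_mul_right hle _).trans (le_of_eq ?_)
        rw [ENNReal.ofReal_mul (by positivity), mul_left_comm, hq,
          ENNReal.div_mul_cancel (by simpa using hcs) ENNReal.ofReal_ne_top]
    _ = _ := lintegral_const_mul _ (by fun_prop)

/-- Sharp Poincaré inequality in `H^1_{0L}(I)`. -/
lemma integral_sq_U_le (w : E) : ∫ s, U w s ^ 2 ∂mu01 ≤ 4 / Real.pi ^ 2 * ‖w‖ ^ 2 := by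
  have hm : Measurable (fun s => ‖(w : ℝ → ℝ) s‖ₑ) := (Lp.stronglyMeasurable w).measurable.enorm
  have h := lintegral_sq_lintegral_le hm
  have h1 : ENNReal.ofReal (∫ s, U w s ^ 2 ∂mu01) ≤
      ∫⁻ t, (∫⁻ s in Ioc 0 t, ‖(w : ℝ → ℝ) s‖ₑ ∂mu01) ^ 2 ∂mu01 := by
    have hi : Integrable (fun s => U w s ^ 2) mu01 :=
      integrable_mu01_of_continuousOn ((continuous_U w).pow 2).continuousOn
    rw [ofReal_integral_eq_lintegral_ofReal hi (.of_forall fun s => sq_nonneg _)]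
    refine lintegral_mono fun t => ?_
    rw [← sq_abs, ENNReal.ofReal_pow (abs_nonneg _), ← Real.enorm_eq_ofReal_abs]
    exact pow_le_pow_left' (enorm_integral_le_lintegral_enorm _) 2
  have h2 : ∫⁻ s, ‖(w : ℝ → ℝ) s‖ₑ ^ 2 ∂mu01 = ENNReal.ofReal (‖w‖ ^ 2) := by
    rw [← real_inner_self_eq_norm_sq, inner_eq_integral_mul,
      ofReal_integral_eq_lintegral_ofReal _ (.of_forall fun s => mul_self_nonneg _)]
    · refine lintegral_congr fun s => ?_
      rw [Real.enorm_eq_ofReal_abs, ← ENNReal.ofReal_pow (abs_nonneg _), sq_abs, sq]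
    · simpa [sq] using (Lp.memLp w).integrable_sq
  rw [h2, ← ENNReal.ofReal_mul (by positivity)] at h
  exact (ENNReal.ofReal_le_ofReal_iff (by positivity)).1 (h1.trans h)

lemma norm_le_of_inner_self_eq_integral {w : E} {F : ℝ → ℝ} (hF : ContinuousOn F (Icc 0 1))
    {C k : ℝ} (hk : 0 ≤ k) (hC : 0 ≤ C)
    (hle : ∀ s ∈ Ioo (0:ℝ) 1, F s ≤ C * ‖w‖ + k * U w s ^ 2)
    (h : inner ℝ w w = ∫ s, F s ∂mu01) : (1 - k * (4 / Real.pi ^ 2)) * ‖w‖ ≤ C := by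
  have hae : ∀ᵐ s ∂mu01, s ∈ Ioo (0:ℝ) 1 := ae_restrict_mem measurableSet_Ioo
  have hi : Integrable (fun s => U w s ^ 2) mu01 :=
    integrable_mu01_of_continuousOn ((continuous_U w).pow 2).continuousOn
  have h1 : ∫ s, F s ∂mu01 ≤ ∫ s, (C * ‖w‖ + k * U w s ^ 2) ∂mu01 :=
    integral_mono_ae (integrable_mu01_of_continuousOn hF)
      ((integrable_const _).add (hi.const_mul k)) (hae.mono hle)
  rw [integral_add (integrable_const _) (hi.const_mul k), ← h,
    real_inner_self_eq_norm_sq] at h1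
  simp only [integral_const, probReal_univ, smul_eq_mul, one_mul, integral_const_mul] at h1
  have h2 := mul_le_mul_of_nonneg_left (integral_sq_U_le w) hk
  rcases (norm_nonneg w).eq_or_lt with h0 | h0
  · rw [← h0]; simpa using hC
  · refine le_of_mul_le_mul_right ?_ h0
    nlinarith

lemma continuousOn_design_add_U {α : ℝ → ℝ} (hα : ContinuousOn α (Icc 0 1)) (g : E) :
    ContinuousOn (fun s => α s + U g s) (Icc 0 1) :=
  hα.add (continuous_U g).continuousOn

lemma continuousOn_edot_Dmvec {α : ℝ → ℝ} (hα : ContinuousOn α (Icc 0 1)) (p : ℝ × ℝ) (g : E) :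
    ContinuousOn (fun s => edot p (Dmvec (α s + U g s))) (Icc 0 1) :=
  (continuous_edot_Dmvec p).comp_continuousOn (continuousOn_design_add_U hα g)

lemma continuousOn_edot_D2mvec {α : ℝ → ℝ} (hα : ContinuousOn α (Icc 0 1)) (p : ℝ × ℝ) (g : E) :
    ContinuousOn (fun s => edot p (D2mvec (α s + U g s))) (Icc 0 1) :=
  (continuous_edot_D2mvec p).comp_continuousOn (continuousOn_design_add_U hα g)

lemma IsStateSolF.inner_eq {α : ℝ → ℝ} {p : ℝ × ℝ} {g : E} (h : IsStateSolF α p g) (w : E) :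
    inner ℝ g w = ∫ s, edot p (Dmvec (α s + U g s)) * U w s ∂mu01 := by
  rw [inner_eq_integral_mul]; exact sub_eq_zero.1 (h w)

lemma IsAdjSolF.inner_eq {α : ℝ → ℝ} {p : ℝ × ℝ} {g l : E} {tb : ℝ → ℝ}
    (hα : ContinuousOn α (Icc 0 1)) (htb : ContinuousOn tb (Icc 0 1))
    (h : IsAdjSolF α p g tb l) (w : E) :
    inner ℝ l w = ∫ s, (U l s * edot p (D2mvec (α s + U g s)) + (U g s - tb s)) * U w s ∂mu01 := by
  rw [inner_eq_integral_mul]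
  simp only [add_mul]
  have hw := (continuous_U w).continuousOn (s := Icc (0:ℝ) 1)
  rw [integral_add, ← h w]
  · ring
  · exact integrable_mu01_of_continuousOn
      (((continuous_U l).continuousOn.mul (continuousOn_edot_D2mvec hα p g)).mul hw)
  · exact integrable_mu01_of_continuousOn (((continuous_U g).continuousOn.sub htb).mul hw)

lemma IsStateSolF.norm_le {α : ℝ → ℝ} {p : ℝ × ℝ} {g : E} {K : ℝ} (h : IsStateSolF α p g)
    (hα : ContinuousOn α (Icc 0 1)) (hp : enorm2 p ≤ K) : ‖g‖ ≤ K := by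
  have := norm_le_of_inner_self_eq_integral (k := 0) (C := K)
    ((continuousOn_edot_Dmvec hα p g).mul (continuous_U g).continuousOn) le_rfl
    ((enorm2_nonneg p).trans hp) (fun s _ => ?_) (h.inner_eq g)
  · simpa using this
  · rw [zero_mul, add_zero]
    refine (le_abs_self _).trans ?_
    rw [Pi.mul_apply, abs_mul]
    exact mul_le_mul ((abs_edot_Dmvec_le p _).trans hp) (abs_U_le g s) (abs_nonneg _)
      ((enorm2_nonneg p).trans hp)

lemma IsAdjSolF.norm_le {α : ℝ → ℝ} {p : ℝ × ℝ} {g l : E} {tb : ℝ → ℝ} {K B : ℝ}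
    (hα : ContinuousOn α (Icc 0 1)) (htb : ContinuousOn tb (Icc 0 1))
    (hB : ∀ s ∈ Icc (0:ℝ) 1, |tb s| ≤ B)
    (h : IsAdjSolF α p g tb l) (hp : enorm2 p ≤ K) (hg : ‖g‖ ≤ K) :
    (1 - K * (4 / Real.pi ^ 2)) * ‖l‖ ≤ K + B := by
  have hK := (enorm2_nonneg p).trans hp
  have hB0 : 0 ≤ B := (abs_nonneg _).trans (hB 0 (by simp))
  refine norm_le_of_inner_self_eq_integral
    ((((continuous_U l).continuousOn.mul (continuousOn_edot_D2mvec hα p g)).add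
      ((continuous_U g).continuousOn.sub htb)).mul (continuous_U l).continuousOn) hK
    (by positivity) (fun s hs => ?_) (h.inner_eq hα htb l)
  have h1 : U l s * edot p (D2mvec (α s + U g s)) * U l s ≤ K * U l s ^ 2 := by
    have := (le_abs_self _).trans ((abs_edot_D2mvec_le p (α s + U g s)).trans hp)
    nlinarith [sq_nonneg (U l s)]
  have h2 : (U g s - tb s) * U l s ≤ (K + B) * ‖l‖ := by
    refine (le_abs_self _).trans ?_
    rw [abs_mul]
    refine mul_le_mul ((abs_sub _ _).trans ?_) (abs_U_le l s) (abs_nonneg _) (by positivity)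
    exact add_le_add ((abs_U_le g s).trans hg) (hB s (Ioo_subset_Icc_self hs))
  simp only [Pi.add_apply, Pi.mul_apply, Pi.sub_apply]
  rw [add_mul]
  linarith

lemma abs_edot_Dmvec_sub_edot_le {p p' : ℝ × ℝ} {K : ℝ} (hp' : enorm2 p' ≤ K) (a b : ℝ) :
    |edot p (Dmvec a) - edot p' (Dmvec b)| ≤ enorm2 (p - p') + K * |a - b| := by
  have e : edot p (Dmvec a) - edot p' (Dmvec b) =
      edot (p - p') (Dmvec a) + (edot p' (Dmvec a) - edot p' (Dmvec b)) := by
    rw [edot_sub_left]; ring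
  rw [e]
  refine (abs_add_le _ _).trans (add_le_add (abs_edot_Dmvec_le _ _) ?_)
  exact (abs_edot_Dmvec_sub_le _ _ _).trans (mul_le_mul_of_nonneg_right hp' (abs_nonneg _))

lemma abs_edot_D2mvec_sub_edot_le {p p' : ℝ × ℝ} {K : ℝ} (hp' : enorm2 p' ≤ K) (a b : ℝ) :
    |edot p (D2mvec a) - edot p' (D2mvec b)| ≤ enorm2 (p - p') + K * |a - b| := by
  have e : edot p (D2mvec a) - edot p' (D2mvec b) =
      edot (p - p') (D2mvec a) + (edot p' (D2mvec a) - edot p' (D2mvec b)) := by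
    rw [edot_sub_left]; ring
  rw [e]
  refine (abs_add_le _ _).trans (add_le_add (abs_edot_D2mvec_le _ _) ?_)
  exact (abs_edot_D2mvec_sub_le _ _ _).trans (mul_le_mul_of_nonneg_right hp' (abs_nonneg _))

lemma abs_design_sub_le {α β : ℝ → ℝ} {d : ℝ} (hd : ∀ s ∈ Icc (0:ℝ) 1, |α s - β s| ≤ d)
    (g g' : E) {s : ℝ} (hs : s ∈ Icc (0:ℝ) 1) :
    |(α s + U g s) - (β s + U g' s)| ≤ d + |U (g - g') s| := by
  rw [add_sub_add_comm, ← U_sub]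
  exact (abs_add_le _ _).trans (add_le_add_left (hd s hs) _)

lemma norm_state_sub_le {α β : ℝ → ℝ} {p p' : ℝ × ℝ} {g g' : E} {K d : ℝ}
    (hα : ContinuousOn α (Icc 0 1)) (hβ : ContinuousOn β (Icc 0 1))
    (hd : ∀ s ∈ Icc (0:ℝ) 1, |α s - β s| ≤ d)
    (h : IsStateSolF α p g) (h' : IsStateSolF β p' g') (hp' : enorm2 p' ≤ K) :
    (1 - K * (4 / Real.pi ^ 2)) * ‖g - g'‖ ≤ enorm2 (p - p') + K * d := by
  have hK := (enorm2_nonneg p').trans hp'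
  have hd0 : 0 ≤ d := (abs_nonneg _).trans (hd 0 (by simp))
  have hδ := enorm2_nonneg (p - p')
  set w := g - g' with hw
  have hF := (continuousOn_edot_Dmvec hα p g).mul (continuous_U w).continuousOn
  have hF' := (continuousOn_edot_Dmvec hβ p' g').mul (continuous_U w).continuousOn
  refine norm_le_of_inner_self_eq_integral (hF.sub hF') hK (by positivity) (fun s hs => ?_) ?_
  · simp only [Pi.sub_apply, Pi.mul_apply]
    rw [← sub_mul]
    refine (le_abs_self _).trans ?_
    rw [abs_mul]
    have h1 := abs_edot_Dmvec_sub_edot_le (p := p) hp' (α s + U g s) (β s + U g' s)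
    have h2 := mul_le_mul_of_nonneg_left
      (abs_design_sub_le hd g g' (Ioo_subset_Icc_self hs)) hK
    have h3 := mul_le_mul_of_nonneg_right (h1.trans (add_le_add_right h2 _)) (abs_nonneg (U w s))
    have h4 := mul_le_mul_of_nonneg_left (abs_U_le w s) (by positivity :
      0 ≤ enorm2 (p - p') + K * d)
    refine h3.trans ?_
    rw [← sq_abs (U w s)]
    nlinarith
  · conv_lhs => rw [hw, inner_sub_left, ← hw]
    rw [h.inner_eq w, h'.inner_eq w]
    exact (integral_sub (integrable_mu01_of_continuousOn hF)
      (integrable_mu01_of_continuousOn hF')).symm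

lemma norm_adjoint_sub_le {α β tb : ℝ → ℝ} {p p' : ℝ × ℝ} {g g' l l' : E} {K d M : ℝ}
    (hα : ContinuousOn α (Icc 0 1)) (hβ : ContinuousOn β (Icc 0 1))
    (htb : ContinuousOn tb (Icc 0 1))
    (hd : ∀ s ∈ Icc (0:ℝ) 1, |α s - β s| ≤ d)
    (h : IsAdjSolF α p g tb l) (h' : IsAdjSolF β p' g' tb l')
    (hp : enorm2 p ≤ K) (hp' : enorm2 p' ≤ K) (hM : ‖l'‖ ≤ M) :
    (1 - K * (4 / Real.pi ^ 2)) * ‖l - l'‖ ≤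
      M * (enorm2 (p - p') + K * (d + ‖g - g'‖)) + ‖g - g'‖ := by
  have hK := (enorm2_nonneg p').trans hp'
  have hM0 := (norm_nonneg l').trans hM
  have hd0 : 0 ≤ d := (abs_nonneg _).trans (hd 0 (by simp))
  have hδ := enorm2_nonneg (p - p')
  set w := l - l' with hw
  have hF := ((((continuous_U l).continuousOn.mul (continuousOn_edot_D2mvec hα p g)).add
      ((continuous_U g).continuousOn.sub htb)).mul (continuous_U w).continuousOn)
  have hF' := ((((continuous_U l').continuousOn.mul (continuousOn_edot_D2mvec hβ p' g')).add
      ((continuous_U g').continuousOn.sub htb)).mul (continuous_U w).continuousOn)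
  refine norm_le_of_inner_self_eq_integral (hF.sub hF') hK (by positivity) (fun s hs => ?_) ?_
  · simp only [Pi.sub_apply, Pi.add_apply, Pi.mul_apply]
    set D := edot p (D2mvec (α s + U g s)) with hD
    set D' := edot p' (D2mvec (β s + U g' s)) with hD'
    have e : (U l s * D + (U g s - tb s)) * U w s - (U l' s * D' + (U g' s - tb s)) * U w s
        = D * U w s ^ 2 + (U l' s * (D - D') + U (g - g') s) * U w s := by
      rw [U_sub g g', hw, U_sub l l']; ring
    rw [e]
    have h1 : D * U w s ^ 2 ≤ K * U w s ^ 2 := by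
      refine mul_le_mul_of_nonneg_right ?_ (sq_nonneg _)
      exact (le_abs_self _).trans ((abs_edot_D2mvec_le p _).trans hp)
    have h2 : |D - D'| ≤ enorm2 (p - p') + K * (d + ‖g - g'‖) := by
      refine (abs_edot_D2mvec_sub_edot_le hp' _ _).trans ?_
      gcongr
      exact (abs_design_sub_le hd g g' (Ioo_subset_Icc_self hs)).trans
        (add_le_add_right (abs_U_le _ _) _)
    have h3 : (U l' s * (D - D') + U (g - g') s) * U w s ≤
        (M * (enorm2 (p - p') + K * (d + ‖g - g'‖)) + ‖g - g'‖) * ‖w‖ := by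
      refine (le_abs_self _).trans ?_
      rw [abs_mul]
      refine mul_le_mul ((abs_add_le _ _).trans ?_) (abs_U_le w s) (abs_nonneg _) (by positivity)
      rw [abs_mul]
      exact add_le_add (mul_le_mul ((abs_U_le _ _).trans hM) h2 (abs_nonneg _) hM0) (abs_U_le _ _)
    linarith
  · conv_lhs => rw [hw, inner_sub_left, ← hw]
    rw [h.inner_eq hα htb w, h'.inner_eq hβ htb w]
    exact (integral_sub (integrable_mu01_of_continuousOn hF)
      (integrable_mu01_of_continuousOn hF')).symm

lemma abs_integral_mu01_le {f : ℝ → ℝ} {C : ℝ} (h : ∀ s ∈ Ioo (0:ℝ) 1, |f s| ≤ C) :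
    |∫ s, f s ∂mu01| ≤ C := by
  have := norm_integral_le_of_norm_le_const (μ := mu01) (f := f) (C := C)
    ((ae_restrict_mem measurableSet_Ioo).mono h)
  simpa using this

lemma abs_integral_U_mul_sub_le {α β φ : ℝ → ℝ} {g g' l l' : E} {d M : ℝ}
    (hα : ContinuousOn α (Icc 0 1)) (hβ : ContinuousOn β (Icc 0 1))
    (hd : ∀ s ∈ Icc (0:ℝ) 1, |α s - β s| ≤ d) (hM : ‖l'‖ ≤ M)
    (hφ : ∀ a, |φ a| ≤ 1) (hφ' : ∀ a b, |φ a - φ b| ≤ |a - b|) :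
    |(∫ s, U l s * φ (α s + U g s) ∂mu01) - ∫ s, U l' s * φ (β s + U g' s) ∂mu01| ≤
      ‖l - l'‖ + M * (d + ‖g - g'‖) := by
  have hM0 := (norm_nonneg l').trans hM
  have hφc : Continuous φ := LipschitzWith.continuous (K := 1)
    (LipschitzWith.of_dist_le_mul fun a b => by simpa [Real.dist_eq] using hφ' a b)
  rw [← integral_sub]
  · refine abs_integral_mu01_le fun s hs => ?_
    have e : U l s * φ (α s + U g s) - U l' s * φ (β s + U g' s) =
        U (l - l') s * φ (α s + U g s) +
          U l' s * (φ (α s + U g s) - φ (β s + U g' s)) := by rw [U_sub]; ring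
    rw [e]
    refine (abs_add_le _ _).trans ?_
    rw [abs_mul, abs_mul]
    refine add_le_add ?_ (mul_le_mul ((abs_U_le _ _).trans hM) ?_ (abs_nonneg _) hM0)
    · simpa using mul_le_mul (abs_U_le (l - l') s) (hφ _) (abs_nonneg _) (norm_nonneg _)
    · exact (hφ' _ _).trans ((abs_design_sub_le hd g g' (Ioo_subset_Icc_self hs)).trans
        (add_le_add_right (abs_U_le _ _) _))
  · exact integrable_mu01_of_continuousOn ((continuous_U l).continuousOn.mul
      (hφc.comp_continuousOn (continuousOn_design_add_U hα g)))
  · exact integrable_mu01_of_continuousOn ((continuous_U l').continuousOn.mul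
      (hφc.comp_continuousOn (continuousOn_design_add_U hβ g')))

lemma abs_Dmvec_fst_sub_le (a b : ℝ) : |(Dmvec a).1 - (Dmvec b).1| ≤ |a - b| := by
  simpa [edot, enorm2] using abs_edot_Dmvec_sub_le (1, 0) a b

lemma abs_Dmvec_snd_sub_le (a b : ℝ) : |(Dmvec a).2 - (Dmvec b).2| ≤ |a - b| := by
  simpa [edot, enorm2] using abs_edot_Dmvec_sub_le (0, 1) a b

lemma abs_Dmvec_fst_le (a : ℝ) : |(Dmvec a).1| ≤ 1 := by
  simpa [Dmvec] using Real.abs_sin_le_one a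

lemma abs_Dmvec_snd_le (a : ℝ) : |(Dmvec a).2| ≤ 1 := by
  simpa [Dmvec] using Real.abs_cos_le_one a

lemma enorm2_Tval_sub_le {α β : ℝ → ℝ} {g g' l l' : E} {d M γ : ℝ} (hγ : 0 < γ)
    (hα : ContinuousOn α (Icc 0 1)) (hβ : ContinuousOn β (Icc 0 1))
    (hd : ∀ s ∈ Icc (0:ℝ) 1, |α s - β s| ≤ d) (hM : ‖l'‖ ≤ M) :
    γ * enorm2 (Tval γ α g l - Tval γ β g' l') ≤ 2 * (‖l - l'‖ + M * (d + ‖g - g'‖)) := by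
  have h1 := abs_integral_U_mul_sub_le (g := g) (g' := g') (l := l) hα hβ hd hM
    abs_Dmvec_fst_le abs_Dmvec_fst_sub_le
  have h2 := abs_integral_U_mul_sub_le (g := g) (g' := g') (l := l) hα hβ hd hM
    abs_Dmvec_snd_le abs_Dmvec_snd_sub_le
  refine (mul_le_mul_of_nonneg_left (enorm2_le_abs_add_abs _) hγ.le).trans ?_
  simp only [Tval, Prod.fst_sub, Prod.snd_sub]
  rw [← mul_sub, ← mul_sub, abs_mul, abs_mul, ← mul_add, ← mul_assoc, abs_neg,
    abs_of_pos (by positivity : 0 < 1 / γ), mul_one_div_cancel hγ.ne']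
  linarith

lemma enorm2_Tval_le {α : ℝ → ℝ} {g l : E} {M γ : ℝ} (hγ : 0 < γ) (hM : ‖l‖ ≤ M) :
    γ * enorm2 (Tval γ α g l) ≤ 2 * M := by
  have hM0 := (norm_nonneg l).trans hM
  have h : ∀ φ : ℝ → ℝ, (∀ a, |φ a| ≤ 1) → |∫ s, U l s * φ (α s + U g s) ∂mu01| ≤ M := by
    refine fun φ hφ => abs_integral_mu01_le fun s _ => ?_
    rw [abs_mul]
    simpa using mul_le_mul ((abs_U_le l s).trans hM) (hφ _) (abs_nonneg _) hM0
  refine (mul_le_mul_of_nonneg_left (enorm2_le_abs_add_abs _) hγ.le).trans ?_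
  simp only [Tval]
  rw [abs_mul, abs_mul, ← mul_add, ← mul_assoc, abs_neg,
    abs_of_pos (by positivity : 0 < 1 / γ), mul_one_div_cancel hγ.ne']
  linarith [h _ abs_Dmvec_fst_le, h _ abs_Dmvec_snd_le]

lemma abs_U_mul_edot_sub_le {α β : ℝ → ℝ} {p p' : ℝ × ℝ} {g g' l l' : E} {d M : ℝ}
    (hd : ∀ s ∈ Icc (0:ℝ) 1, |α s - β s| ≤ d) (hM : ‖l'‖ ≤ M) {s : ℝ} (hs : s ∈ Icc (0:ℝ) 1) :
    |U l s * edot p (D2mvec (α s + U g s)) - U l' s * edot p' (D2mvec (β s + U g' s))| ≤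
      ‖l - l'‖ * enorm2 p + M * (enorm2 (p - p') + enorm2 p' * (d + ‖g - g'‖)) := by
  have hM0 := (norm_nonneg l').trans hM
  set D := edot p (D2mvec (α s + U g s)) with hD
  set D' := edot p' (D2mvec (β s + U g' s)) with hD'
  have e : U l s * D - U l' s * D' = U (l - l') s * D + U l' s * (D - D') := by
    rw [U_sub]; ring
  rw [e]
  refine (abs_add_le _ _).trans ?_
  rw [abs_mul, abs_mul]
  refine add_le_add ?_ (mul_le_mul ((abs_U_le _ _).trans hM) ?_ (abs_nonneg _) hM0)
  · exact mul_le_mul (abs_U_le _ _) (abs_edot_D2mvec_le _ _) (abs_nonneg _) (norm_nonneg _)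
  · refine (abs_edot_D2mvec_sub_edot_le le_rfl _ _).trans (add_le_add_right ?_ _)
    exact mul_le_mul_of_nonneg_left ((abs_design_sub_le hd g g' hs).trans
      (add_le_add_right (abs_U_le _ _) _)) (enorm2_nonneg _)

/-- `p` is a fixed point, in the disc of radius `K`, of the chain map for the design `α`, with
state `g` and multiplier `l`. -/
structure IsChainFixedPoint (K γ : ℝ) (tb α : ℝ → ℝ) (p : ℝ × ℝ) (g l : E) : Prop where
  norm_le : enorm2 p ≤ K
  state : IsStateSolF α p g
  adjoint : IsAdjSolF α p g tb l
  eq_Tval : p = Tval γ α g l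

lemma one_sub_mul_four_div_pi_sq_pos {K : ℝ} (hK : K < Real.pi ^ 2 / 4) :
    0 < 1 - K * (4 / Real.pi ^ 2) := by
  have hπ := Real.pi_pos
  rw [sub_pos, ← mul_div_assoc, div_lt_one (by positivity)]
  linarith

/-- For `γ` large, fixed points of the chain map depend on the design in a Lipschitz way, uniformly
in `γ`, and the associated source terms do so with a constant of order `1 / γ`. -/
lemma exists_lipschitz_bounds {K B : ℝ} (hK0 : 0 ≤ K) (hK : K < Real.pi ^ 2 / 4) (hB : 0 ≤ B) :
    ∃ γ₀ C R : ℝ, 0 < γ₀ ∧ 0 ≤ R ∧ ∀ γ, γ₀ < γ → ∀ (tb α β : ℝ → ℝ) (d : ℝ),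
      ContinuousOn tb (Icc 0 1) → (∀ s ∈ Icc (0:ℝ) 1, |tb s| ≤ B) →
      ContinuousOn α (Icc 0 1) → ContinuousOn β (Icc 0 1) →
      (∀ s ∈ Icc (0:ℝ) 1, |α s - β s| ≤ d) →
      ∀ (p p' : ℝ × ℝ) (g g' l l' : E),
        IsChainFixedPoint K γ tb α p g l → IsChainFixedPoint K γ tb β p' g' l' →
        enorm2 (p - p') ≤ C * d ∧ ‖g - g'‖ ≤ C * d ∧ ‖l - l'‖ ≤ C * d ∧
        ∀ s ∈ Icc (0:ℝ) 1,
          γ * |U l s * edot p (D2mvec (α s + U g s)) -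
            U l' s * edot p' (D2mvec (β s + U g' s))| ≤ R * d := by
  set κ := 1 - K * (4 / Real.pi ^ 2) with hκ
  have hκ0 : 0 < κ := one_sub_mul_four_div_pi_sq_pos hK
  set M := (K + B) / κ with hMdef
  have hM0 : 0 ≤ M := by positivity
  set X := (1 + K) / κ with hX
  have hX0 : 0 ≤ X := by positivity
  set Y := (M * (1 + K + K * X) + X) / κ with hY
  have hY0 : 0 ≤ Y := by positivity
  set Z := 2 * (Y + M + M * X) with hZ
  have hZ0 : 0 ≤ Z := by positivity
  refine ⟨2 * Z + 1, 1 + 2 * X + 2 * Y, 4 * Y * M + 2 * M * Z + 2 * M ^ 2 * (1 + 2 * X),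
    by positivity, by positivity, ?_⟩
  intro γ hγ tb α β d htb htbB hα hβ hd p p' g g' l l' h h'
  have hγ0 : 0 < γ := by linarith
  have hd0 : 0 ≤ d := (abs_nonneg _).trans (hd 0 (by simp))
  have hl' : ‖l'‖ ≤ M := (le_div_iff₀' hκ0).2
    (h'.adjoint.norm_le hβ htb htbB h'.norm_le (h'.state.norm_le hβ h'.norm_le))
  have hl : ‖l‖ ≤ M := (le_div_iff₀' hκ0).2
    (h.adjoint.norm_le hα htb htbB h.norm_le (h.state.norm_le hα h.norm_le))
  have h1 := norm_state_sub_le hα hβ hd h.state h'.state h'.norm_le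
  have h2 := norm_adjoint_sub_le hα hβ htb hd h.adjoint h'.adjoint h.norm_le h'.norm_le hl'
  have h3 := enorm2_Tval_sub_le (g := g) (g' := g') (l := l) hγ0 hα hβ hd hl'
  rw [← h.eq_Tval, ← h'.eq_Tval] at h3
  have h4 := enorm2_Tval_le (α := α) (g := g) hγ0 hl
  rw [← h.eq_Tval] at h4
  have h4' := enorm2_Tval_le (α := β) (g := g') hγ0 hl'
  rw [← h'.eq_Tval] at h4'
  have h5 := fun s (hs : s ∈ Icc (0:ℝ) 1) =>
    abs_U_mul_edot_sub_le (p := p) (p' := p') (g := g) (g' := g') (l := l) hd hl' hs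
  rw [← hκ] at h1 h2
  set δ := enorm2 (p - p') with hδ
  have hδ0 : 0 ≤ δ := enorm2_nonneg _
  set x := ‖g - g'‖ with hx
  have hx0 : 0 ≤ x := norm_nonneg _
  set y := ‖l - l'‖ with hy
  have hy0 : 0 ≤ y := norm_nonneg _
  have hxX : x ≤ X * (δ + d) := by
    rw [hX, div_mul_eq_mul_div, le_div_iff₀' hκ0]
    nlinarith [mul_nonneg hK0 hδ0]
  have hyY : y ≤ Y * (δ + d) := by
    rw [hY, div_mul_eq_mul_div, le_div_iff₀' hκ0]
    have : M * (δ + K * (d + x)) ≤ M * ((1 + K + K * X) * (δ + d)) := by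
      refine mul_le_mul_of_nonneg_left ?_ hM0
      nlinarith [mul_nonneg hK0 hδ0, mul_le_mul_of_nonneg_left hxX hK0]
    nlinarith
  have hδZ : γ * δ ≤ Z * (δ + d) := by
    have := mul_le_mul_of_nonneg_left hxX hM0
    have := mul_nonneg hM0 hδ0
    rw [hZ]
    nlinarith
  have hδd : δ ≤ d := by
    by_contra! hlt
    have e1 := mul_le_mul_of_nonneg_right hγ.le hδ0
    have e2 := mul_le_mul_of_nonneg_left hlt.le hZ0
    linarith
  have hsum : δ + d ≤ 2 * d := by linarith
  have hδd' : γ * δ ≤ 2 * Z * d := by linarith [mul_le_mul_of_nonneg_left hsum hZ0]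
  have hxd : x ≤ 2 * X * d := by linarith [mul_le_mul_of_nonneg_left hsum hX0]
  have hyd : y ≤ 2 * Y * d := by linarith [mul_le_mul_of_nonneg_left hsum hY0]
  have hXd := mul_nonneg hX0 hd0
  have hYd := mul_nonneg hY0 hd0
  refine ⟨by linarith, by linarith, by linarith, fun s hs => ?_⟩
  refine (mul_le_mul_of_nonneg_left (h5 s hs) hγ0.le).trans ?_
  have a1 : y * (γ * enorm2 p) ≤ 2 * Y * d * (2 * M) :=
    mul_le_mul hyd h4 (mul_nonneg hγ0.le (enorm2_nonneg _)) (by positivity)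
  have a2 : M * (γ * δ) ≤ M * (2 * Z * d) := mul_le_mul_of_nonneg_left hδd' hM0
  have a3 : M * (γ * enorm2 p' * (d + x)) ≤ M * (2 * M * (d + 2 * X * d)) :=
    mul_le_mul_of_nonneg_left (mul_le_mul h4' (by linarith) (by positivity) (by positivity)) hM0
  linarith

/-- The solution of `-u'' = f`, `u(0) = u'(1) = 0`. -/
noncomputable def doubleIntegral (f : ℝ → ℝ) (t : ℝ) : ℝ :=
  ∫ s' in (0:ℝ)..t, ∫ s'' in s'..(1:ℝ), f s''

lemma doubleIntegral_congr {f g : ℝ → ℝ} (h : EqOn f g (Icc 0 1)) :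
    EqOn (doubleIntegral f) (doubleIntegral g) (Icc 0 1) := by
  intro t ht
  refine intervalIntegral.integral_congr fun s hs => ?_
  rw [uIcc_of_le ht.1] at hs
  refine intervalIntegral.integral_congr fun r hr => ?_
  rw [uIcc_of_le (hs.2.trans ht.2)] at hr
  exact h ⟨hs.1.trans hr.1, hr.2⟩

lemma hasDerivAt_integral_left {f : ℝ → ℝ} (hf : Continuous f) (t : ℝ) :
    HasDerivAt (fun s' => ∫ s in s'..(1:ℝ), f s) (-f t) t :=
  intervalIntegral.integral_hasDerivAt_left (hf.intervalIntegrable _ _)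
    hf.stronglyMeasurable.stronglyMeasurableAtFilter hf.continuousAt

lemma continuous_integral_left {f : ℝ → ℝ} (hf : Continuous f) :
    Continuous (fun s' => ∫ s in s'..(1:ℝ), f s) :=
  continuous_iff_continuousAt.2 fun t => (hasDerivAt_integral_left hf t).continuousAt

lemma hasDerivAt_doubleIntegral {f : ℝ → ℝ} (hf : Continuous f) (t : ℝ) :
    HasDerivAt (doubleIntegral f) (∫ s in t..(1:ℝ), f s) t :=
  intervalIntegral.integral_hasDerivAt_right
    ((continuous_integral_left hf).intervalIntegrable _ _)
    (continuous_integral_left hf).stronglyMeasurable.stronglyMeasurableAtFilter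
    (continuous_integral_left hf).continuousAt

lemma exists_continuous_eqOn_Icc {f : ℝ → ℝ} (hf : ContinuousOn f (Icc 0 1)) :
    ∃ g : ℝ → ℝ, Continuous g ∧ EqOn f g (Icc 0 1) :=
  ⟨fun t => f (projIcc (0:ℝ) 1 zero_le_one t),
    hf.comp_continuous (continuous_subtype_val.comp continuous_projIcc) fun t => (projIcc _ _ _ t).2,
    fun t ht => by simp [projIcc_of_mem zero_le_one ht]⟩

lemma continuousOn_doubleIntegral {f : ℝ → ℝ} (hf : ContinuousOn f (Icc 0 1)) :
    ContinuousOn (doubleIntegral f) (Icc 0 1) := by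
  obtain ⟨g, hg, hfg⟩ := exists_continuous_eqOn_Icc hf
  exact (continuous_iff_continuousAt.2 fun t =>
    (hasDerivAt_doubleIntegral hg t).continuousAt).continuousOn.congr (doubleIntegral_congr hfg)

lemma abs_doubleIntegral_sub_le {f g : ℝ → ℝ} (hf : ContinuousOn f (Icc 0 1))
    (hg : ContinuousOn g (Icc 0 1)) {C : ℝ} (hC : ∀ s ∈ Icc (0:ℝ) 1, |f s - g s| ≤ C)
    {t : ℝ} (ht : t ∈ Icc (0:ℝ) 1) : |doubleIntegral f t - doubleIntegral g t| ≤ C := by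
  obtain ⟨f', hf', hff'⟩ := exists_continuous_eqOn_Icc hf
  obtain ⟨g', hg', hgg'⟩ := exists_continuous_eqOn_Icc hg
  have hC0 : 0 ≤ C := (abs_nonneg _).trans (hC 0 (by simp))
  rw [doubleIntegral_congr hff' ht, doubleIntegral_congr hgg' ht, doubleIntegral, doubleIntegral,
    ← intervalIntegral.integral_sub ((continuous_integral_left hf').intervalIntegrable _ _)
      ((continuous_integral_left hg').intervalIntegrable _ _)]
  have inner_le : ∀ s ∈ uIoc 0 t,
      ‖(∫ r in s..(1:ℝ), f' r) - ∫ r in s..(1:ℝ), g' r‖ ≤ C := by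
    intro s hs
    rw [uIoc_of_le ht.1] at hs
    have hs1 : s ≤ 1 := hs.2.trans ht.2
    rw [← intervalIntegral.integral_sub (hf'.intervalIntegrable _ _) (hg'.intervalIntegrable _ _)]
    refine (intervalIntegral.norm_integral_le_of_norm_le_const (C := C) fun r hr => ?_).trans ?_
    · rw [uIoc_of_le hs1] at hr
      have hr' : r ∈ Icc (0:ℝ) 1 := ⟨hs.1.le.trans hr.1.le, hr.2⟩
      rw [← hff' hr', ← hgg' hr']
      exact hC r hr'
    · rw [abs_of_nonneg (sub_nonneg.2 hs1)]
      nlinarith [hs.1]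
  refine (intervalIntegral.norm_integral_le_of_norm_le_const inner_le).trans ?_
  rw [sub_zero, abs_of_nonneg ht.1]
  nlinarith [ht.2]

lemma abs_sub_le_iSup_Icc {f g : ℝ → ℝ} (hf : ContinuousOn f (Icc 0 1))
    (hg : ContinuousOn g (Icc 0 1)) {t : ℝ} (ht : t ∈ Icc (0:ℝ) 1) :
    |f t - g t| ≤ ⨆ s : Icc (0:ℝ) 1, |f ↑s - g ↑s| := by
  have hc : Continuous fun s : Icc (0:ℝ) 1 => |f ↑s - g ↑s| :=
    (hf.domRestrict.sub hg.domRestrict).abs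
  exact le_ciSup (isCompact_range hc).bddAbove (⟨t, ht⟩ : Icc (0:ℝ) 1)

/-- A map on functions that contracts the sup norm on `[0,1]` has a fixed point, unique on
`[0,1]`. -/
lemma exists_unique_fixedPoint_of_contraction {A : (ℝ → ℝ) → ℝ → ℝ}
    (hcont : ∀ α, ContinuousOn α (Icc (0:ℝ) 1) → ContinuousOn (A α) (Icc (0:ℝ) 1))
    (hA : ∀ α β d, ContinuousOn α (Icc (0:ℝ) 1) → ContinuousOn β (Icc (0:ℝ) 1) →
      (∀ s ∈ Icc (0:ℝ) 1, |α s - β s| ≤ d) → ∀ t ∈ Icc (0:ℝ) 1, |A α t - A β t| ≤ 1 / 2 * d) :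
    ∃ αs : ℝ → ℝ, Continuous αs ∧ (∀ t ∈ Icc (0:ℝ) 1, A αs t = αs t) ∧
      ∀ β : ℝ → ℝ, ContinuousOn β (Icc (0:ℝ) 1) → (∀ t ∈ Icc (0:ℝ) 1, A β t = β t) →
        ∀ t ∈ Icc (0:ℝ) 1, β t = αs t := by
  let ext (f : C(Icc (0:ℝ) 1, ℝ)) : ℝ → ℝ := IccExtend zero_le_one f
  have hext (f) : Continuous (ext f) := f.continuous.Icc_extend'
  let Φ (f : C(Icc (0:ℝ) 1, ℝ)) : C(Icc (0:ℝ) 1, ℝ) :=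
    ⟨fun t => A (ext f) t, (hcont _ (hext f).continuousOn).domRestrict⟩
  have hΦ : ContractingWith (1 / 2) Φ := by
    refine ⟨by rw [← NNReal.coe_lt_coe]; norm_num, LipschitzWith.of_dist_le_mul fun f g => ?_⟩
    refine (ContinuousMap.dist_le (by positivity)).2 fun t => ?_
    have := hA (ext f) (ext g) (dist f g) (hext f).continuousOn (hext g).continuousOn
      (fun s hs => by
        simp only [ext, IccExtend_of_mem _ _ hs]
        exact ContinuousMap.dist_apply_le_dist (f := f) (g := g) _) t t.2
    exact this.trans_eq (by norm_num)
  have hfix : ∀ t ∈ Icc (0:ℝ) 1, A (ext (hΦ.fixedPoint Φ)) t = ext (hΦ.fixedPoint Φ) t := by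
    intro t ht
    have := DFunLike.congr_fun hΦ.fixedPoint_isFixedPt (⟨t, ht⟩ : Icc (0:ℝ) 1)
    simp only [ext, IccExtend_of_mem _ _ ht]
    exact this
  refine ⟨ext (hΦ.fixedPoint Φ), hext _, hfix, fun β hβ hβfix t ht => ?_⟩
  set αs := ext (hΦ.fixedPoint Φ) with hαs
  have hle := fun s (hs : s ∈ Icc (0:ℝ) 1) =>
    abs_sub_le_iSup_Icc hβ (hext (hΦ.fixedPoint Φ)).continuousOn hs
  have hhalf := hA β αs _ hβ (hext _).continuousOn hle
  have : Nonempty (Icc (0:ℝ) 1) := ⟨⟨0, by simp⟩⟩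
  have hsup := ciSup_le fun s : Icc (0:ℝ) 1 => by
    have := hhalf s s.2
    rwa [hβfix s s.2, hfix s s.2] at this
  have := hle t ht
  exact sub_eq_zero.1 (abs_nonpos_iff.1 (by linarith))

/-- Proposition `prop-step1+2` (ii): the map `A : C([0,1]) → C([0,1])`,
defined by solving `−A(α)'' = −(1/ε)Σᵢ λᵢ(α) hᵢ(α)·D²m(α+ϑᵢ(α))`, `A(α)(0)=0`,
`A(α)'(1)=0` at the fixed point `h(α)` of the chain map `T^{(α)}`, is a contraction for
the sup norm for all `γ` larger than some `γ* > γ₁`, and its unique fixed point `α`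
satisfies `α ∈ C²([0,1])`, `α(0) = α'(1) = 0`. -/
theorem design_map_contraction (n : ℕ)
    (tb : Fin n → ℝ → ℝ) (htb : ∀ i, ContinuousOn (tb i) (Icc (0:ℝ) 1))
    (ε : ℝ) (hε : 0 < ε)
    (K : ℝ) (hK0 : 0 < K) (hK : K < Real.pi ^ 2 / 4)
    (γ₁ : ℝ) -- the threshold below which the chain maps `T^{(α)}` have fixed points
    (hγ₁ : ∀ γ : ℝ, γ₁ < γ → ∀ α : ℝ → ℝ, ContinuousOn α (Icc (0:ℝ) 1) →
      ∃ (hα : Fin n → ℝ × ℝ) (g l : Fin n → E),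
        (∀ i, enorm2 (hα i) ≤ K) ∧
        (∀ i, IsStateSolF α (hα i) (g i)) ∧
        (∀ i, IsAdjSolF α (hα i) (g i) (tb i) (l i)) ∧
        (∀ i, hα i = Tval γ α (g i) (l i))) :
    ∃ γs : ℝ, γ₁ < γs ∧ ∀ γ : ℝ, γs < γ →
      ∃ Amap : (ℝ → ℝ) → (ℝ → ℝ),
        -- `A` is given on continuous designs by the explicit double-integral formula,
        -- through the fixed point `h(α)` of `T^{(α)}` and its states and multipliers:
        (∀ α : ℝ → ℝ, ContinuousOn α (Icc (0:ℝ) 1) →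
          ∀ (hα : Fin n → ℝ × ℝ) (g l : Fin n → E),
            (∀ i, enorm2 (hα i) ≤ K) →
            (∀ i, IsStateSolF α (hα i) (g i)) →
            (∀ i, IsAdjSolF α (hα i) (g i) (tb i) (l i)) →
            (∀ i, hα i = Tval γ α (g i) (l i)) →
            ∀ t : ℝ, Amap α t =
              -(1 / ε) * ∑ i, ∫ s' in (0:ℝ)..t,
                (∫ s'' in s'..(1:ℝ),
                  U (l i) s'' * edot (hα i) (D2mvec (α s'' + U (g i) s'')))) ∧
        -- `A` is a contraction with respect to the sup norm on `[0,1]`: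
        (∃ Lc : ℝ, 0 ≤ Lc ∧ Lc < 1 ∧
          ∀ α β : ℝ → ℝ, ContinuousOn α (Icc (0:ℝ) 1) → ContinuousOn β (Icc (0:ℝ) 1) →
            (⨆ t : Icc (0:ℝ) 1, |Amap α ↑t - Amap β ↑t|) ≤
              Lc * ⨆ t : Icc (0:ℝ) 1, |α ↑t - β ↑t|) ∧
        -- `A` has a unique continuous fixed point, which is `C²` with `α(0)=α'(1)=0`:
        (∃ αstar : ℝ → ℝ, ContinuousOn αstar (Icc (0:ℝ) 1) ∧
          (∀ t ∈ Icc (0:ℝ) 1, Amap αstar t = αstar t) ∧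
          (∀ β : ℝ → ℝ, ContinuousOn β (Icc (0:ℝ) 1) →
            (∀ t ∈ Icc (0:ℝ) 1, Amap β t = β t) → ∀ t ∈ Icc (0:ℝ) 1, β t = αstar t) ∧
          (∃ a1 a2 : ℝ → ℝ, ContinuousOn a2 (Icc (0:ℝ) 1) ∧
            (∀ t ∈ Icc (0:ℝ) 1, HasDerivWithinAt αstar (a1 t) (Icc (0:ℝ) 1) t) ∧
            (∀ t ∈ Icc (0:ℝ) 1, HasDerivWithinAt a1 (a2 t) (Icc (0:ℝ) 1) t) ∧
            αstar 0 = 0 ∧ a1 1 = 0)) := by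
  classical
  choose b hb using fun i => isCompact_Icc.exists_bound_of_continuousOn (htb i)
  have htbB : ∀ i, ∀ s ∈ Icc (0:ℝ) 1, |tb i s| ≤ ∑ j, |b j| := fun i s hs =>
    (hb i s hs).trans ((le_abs_self _).trans
      (Finset.single_le_sum (f := fun j => |b j|) (fun j _ => abs_nonneg _) (Finset.mem_univ i)))
  obtain ⟨γ₀, C, R, hγ₀, hR, hlip⟩ := exists_lipschitz_bounds hK0.le hK
    (Finset.sum_nonneg fun j (_ : j ∈ Finset.univ) => abs_nonneg (b j))
  refine ⟨max γ₁ (max γ₀ (2 * n * R / ε)) + 1, by linarith [le_max_left γ₁ (max γ₀ (2 * n * R / ε))],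
    fun γ hγ => ?_⟩
  have hγγ₁ : γ₁ < γ := by linarith [le_max_left γ₁ (max γ₀ (2 * n * R / ε))]
  have hmax := le_max_right γ₁ (max γ₀ (2 * n * R / ε))
  have hγγ₀ : γ₀ < γ := by linarith [le_max_left γ₀ (2 * n * R / ε)]
  have hγR : 2 * n * R / ε ≤ γ := by linarith [le_max_right γ₀ (2 * n * R / ε)]
  have hγ0 : 0 < γ := hγ₀.trans hγγ₀
  choose p g l hp hg hl hT using hγ₁ γ hγγ₁
  have hsol : ∀ α hα i, IsChainFixedPoint K γ (tb i) α (p α hα i) (g α hα i) (l α hα i) :=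
    fun α hα i => ⟨hp α hα i, hg α hα i, hl α hα i, hT α hα i⟩
  let A : (ℝ → ℝ) → ℝ → ℝ := fun α t =>
    if hα : ContinuousOn α (Icc (0:ℝ) 1) then
      -(1 / ε) * ∑ i, doubleIntegral (fun s =>
        U (l α hα i) s * edot (p α hα i) (D2mvec (α s + U (g α hα i) s))) t
    else 0
  have hAeq : ∀ α (hα : ContinuousOn α (Icc (0:ℝ) 1)) t, A α t =
      -(1 / ε) * ∑ i, doubleIntegral (fun s =>
        U (l α hα i) s * edot (p α hα i) (D2mvec (α s + U (g α hα i) s))) t :=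
    fun α hα t => dif_pos hα
  have hsrc : ∀ α (hα : ContinuousOn α (Icc (0:ℝ) 1)) i, ContinuousOn (fun s =>
      U (l α hα i) s * edot (p α hα i) (D2mvec (α s + U (g α hα i) s))) (Icc 0 1) :=
    fun α hα i => (continuous_U _).continuousOn.mul (continuousOn_edot_D2mvec hα _ _)
  have hAcont : ∀ α, ContinuousOn α (Icc (0:ℝ) 1) → ContinuousOn (A α) (Icc (0:ℝ) 1) := by
    intro α hα
    rw [funext (hAeq α hα)]
    exact continuousOn_const.mul (continuousOn_finsetSum _ fun i _ =>
      continuousOn_doubleIntegral (hsrc α hα i))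
  have hA : ∀ α β d, ContinuousOn α (Icc (0:ℝ) 1) → ContinuousOn β (Icc (0:ℝ) 1) →
      (∀ s ∈ Icc (0:ℝ) 1, |α s - β s| ≤ d) →
      ∀ t ∈ Icc (0:ℝ) 1, |A α t - A β t| ≤ 1 / 2 * d := by
    intro α β d hα hβ hd t ht
    have hd0 : 0 ≤ d := (abs_nonneg _).trans (hd 0 (by simp))
    rw [hAeq α hα, hAeq β hβ, ← mul_sub, ← Finset.sum_sub_distrib, abs_mul, abs_neg,
      abs_of_pos (by positivity : 0 < 1 / ε)]
    have hterm : ∀ i, |doubleIntegral (fun s =>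
        U (l α hα i) s * edot (p α hα i) (D2mvec (α s + U (g α hα i) s))) t -
        doubleIntegral (fun s =>
          U (l β hβ i) s * edot (p β hβ i) (D2mvec (β s + U (g β hβ i) s))) t| ≤ R * d / γ :=
      fun i => abs_doubleIntegral_sub_le (hsrc α hα i) (hsrc β hβ i)
        (fun s hs => (le_div_iff₀' hγ0).2 ((hlip γ hγγ₀ (tb i) α β d (htb i) (htbB i) hα hβ hd
          _ _ _ _ _ _ (hsol α hα i) (hsol β hβ i)).2.2.2 s hs)) ht
    refine (mul_le_mul_of_nonneg_left ((Finset.abs_sum_le_sum_abs _ _).trans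
      (Finset.sum_le_sum fun i _ => hterm i)) (by positivity)).trans ?_
    rw [Finset.sum_const, Finset.card_univ, Fintype.card_fin, nsmul_eq_mul]
    have hRγ : n * R / (ε * γ) ≤ 1 / 2 := by
      rw [div_le_iff₀ (by positivity)]
      rw [div_le_iff₀ hε] at hγR
      linarith
    calc 1 / ε * (n * (R * d / γ)) = n * R / (ε * γ) * d := by field_simp
      _ ≤ 1 / 2 * d := mul_le_mul_of_nonneg_right hRγ hd0
  refine ⟨A, ?_, ⟨1 / 2, by norm_num, by norm_num, ?_⟩, ?_⟩
  · intro α hα p' g' l' hp' hg' hl' hT' t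
    have huniq : ∀ i, p α hα i = p' i ∧ g α hα i = g' i ∧ l α hα i = l' i := by
      intro i
      obtain ⟨h1, h2, h3, -⟩ := hlip γ hγγ₀ (tb i) α α 0 (htb i) (htbB i) hα hα (by simp)
        _ _ _ _ _ _ (hsol α hα i) ⟨hp' i, hg' i, hl' i, hT' i⟩
      rw [mul_zero] at h1 h2 h3
      exact ⟨sub_eq_zero.1 (eq_zero_of_enorm2_eq_zero (h1.antisymm (enorm2_nonneg _))),
        sub_eq_zero.1 (norm_le_zero_iff.1 h2), sub_eq_zero.1 (norm_le_zero_iff.1 h3)⟩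
    rw [hAeq α hα]
    refine congrArg _ (Finset.sum_congr rfl fun i _ => ?_)
    obtain ⟨h1, h2, h3⟩ := huniq i
    rw [h1, h2, h3, doubleIntegral]
  · intro α β hα hβ
    have : Nonempty (Icc (0:ℝ) 1) := ⟨⟨0, by simp⟩⟩
    exact ciSup_le fun t =>
      hA α β _ hα hβ (fun s hs => abs_sub_le_iSup_Icc hα hβ hs) t t.2
  · obtain ⟨αs, hαs, hfix, huniq⟩ := exists_unique_fixedPoint_of_contraction hAcont hA
    have hαs' := hαs.continuousOn (s := Icc (0:ℝ) 1)
    refine ⟨αs, hαs', hfix, huniq, ?_⟩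
    set φ : Fin n → ℝ → ℝ := fun i s => U (l αs hαs' i) s *
      edot (p αs hαs' i) (D2mvec (αs s + U (g αs hαs' i) s)) with hφdef
    have hφ : ∀ i, Continuous (φ i) := fun i => (continuous_U _).mul
      ((continuous_edot_D2mvec _).comp (hαs.add (continuous_U _)))
    have heq : ∀ t ∈ Icc (0:ℝ) 1, αs t = -(1 / ε) * ∑ i, doubleIntegral (φ i) t :=
      fun t ht => (hfix t ht).symm.trans (hAeq αs hαs' t)
    refine ⟨fun t => -(1 / ε) * ∑ i, ∫ s in t..(1:ℝ), φ i s, fun t => -(1 / ε) * ∑ i, -φ i t,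
      ?_, fun t ht => ?_, fun t _ => ?_, ?_, ?_⟩
    · exact (continuous_const.mul (continuous_finsetSum _ fun i _ => (hφ i).neg)).continuousOn
    · exact ((HasDerivAt.fun_sum fun i _ =>
        hasDerivAt_doubleIntegral (hφ i) t).const_mul _).hasDerivWithinAt.congr heq (heq t ht)
    · exact ((HasDerivAt.fun_sum fun i _ =>
        hasDerivAt_integral_left (hφ i) t).const_mul _).hasDerivWithinAt
    · rw [heq 0 (by simp)]
      simp [doubleIntegral]
    · simp
end
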